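/- Let 1 < q < p < ∞. There exist a constant C and an integer N₀ (both depending only on p, q and φ₀) such that for every integer N ≥ N₀, every finite set E of Haar indices with #HF(E) ≤ 2^N, and every Schwartz function f : ℝ → ℂ, one has ‖P_E f‖_{F^{−1+1/q}_{p,q}} ≤ C · N^{1−1/q} · Z_N(E)^{1/q} · ‖f‖_{F^{−1+1/q}_{p,q}}, where Z_N(E) = max_{k ∈ ℤ} #{ j ∈ HF(E) : |j − k| ≤ N }. -/

import Mathlib

open MeasureTheory Real FourierTransform
open scoped ENNReal

noncomputable section

def haarFn (j : ℕ) (μ : ℤ) : ℝ → ℂ := fun x =>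
  (Set.Ico ((2:ℝ)^(-(j:ℤ)) * μ) ((2:ℝ)^(-(j:ℤ)) * (μ + 1/2))).indicator (fun _ => (1:ℂ)) x
  - (Set.Ico ((2:ℝ)^(-(j:ℤ)) * (μ + 1/2)) ((2:ℝ)^(-(j:ℤ)) * (μ + 1))).indicator (fun _ => (1:ℂ)) x

def haarProj (E : Finset (ℕ × ℤ)) (f : ℝ → ℂ) : ℝ → ℂ := fun x =>
  ∑ e ∈ E, (2:ℂ)^e.1 * (∫ y : ℝ, f y * haarFn e.1 e.2 y) * haarFn e.1 e.2 x

def HFset (E : Finset (ℕ × ℤ)) : Finset ℕ := E.image Prod.fst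

def conv (f g : ℝ → ℂ) : ℝ → ℂ := fun x => ∫ t : ℝ, f t * g (x - t)

def LPop (φ₀ : ℝ → ℂ) (k : ℕ) (g : ℝ → ℂ) : ℝ → ℂ :=
  if k = 0 then conv g (𝓕⁻ φ₀)
  else conv g (fun x => (2:ℂ)^k * (𝓕⁻ (fun ξ => φ₀ ξ - φ₀ (2*ξ))) ((2:ℝ)^k * x))

def FNorm (φ₀ : ℝ → ℂ) (p q s : ℝ) (g : ℝ → ℂ) : ℝ≥0∞ :=
  (∫⁻ x : ℝ, (∑' k : ℕ, ENNReal.ofReal ((2:ℝ)^((k:ℝ)*s*q)) *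
      (ENNReal.ofReal ‖LPop φ₀ k g x‖)^q)^(p/q) ∂volume)^(1/p)

/-- $Z_N(E) = \max_{k\in\mathbb Z}\#\{j\in \mathrm{HF}(E): |j-k|\le N\}$. -/
def ZN (E : Finset (ℕ × ℤ)) (N : ℕ) : ℕ :=
  sSup {c : ℕ | ∃ k : ℤ, c = ((HFset E).filter (fun (j : ℕ) => |(j:ℤ) - k| ≤ (N:ℤ))).card}

/-! ### The Hardy–Littlewood maximal function on the line -/

/-- The centred Hardy–Littlewood maximal function, averages being normalized by the radius. -/
def hlMax (w : ℝ → ℝ≥0∞) (y : ℝ) : ℝ≥0∞ :=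
  ⨆ ρ : {ρ : ℝ // 0 < ρ}, (ENNReal.ofReal ρ)⁻¹ * ∫⁻ x in Metric.ball y ρ, w x

theorem exists_radius_of_lt_hlMax {w : ℝ → ℝ≥0∞} {y a : ℝ} (h : ENNReal.ofReal a < hlMax w y) :
    ∃ ρ : ℝ, 0 < ρ ∧ ENNReal.ofReal (a * ρ) < ∫⁻ x in Metric.ball y ρ, w x := by
  obtain ⟨⟨ρ, hρ⟩, h⟩ := lt_iSup_iff.1 h
  refine ⟨ρ, hρ, ?_⟩
  have h0 : ENNReal.ofReal ρ ≠ 0 := by simpa using hρ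
  rw [mul_comm, ENNReal.ofReal_mul hρ.le, mul_comm, ← ENNReal.lt_div_iff_mul_lt (Or.inl h0)
    (Or.inl ENNReal.ofReal_ne_top), ENNReal.div_eq_inv_mul]
  exact h

theorem volume_lt_hlMax_le {w : ℝ → ℝ≥0∞} (hw : ∫⁻ x, w x ≠ ∞) {a : ℝ} (ha : 0 < a) :
    volume {y | ENNReal.ofReal a < hlMax w y} ≤ ENNReal.ofReal (10 / a) * ∫⁻ x, w x := by
  let t : Set (ℝ × ℝ) :=
    {b | 0 < b.2 ∧ ENNReal.ofReal (a * b.2) < ∫⁻ x in Metric.ball b.1 b.2, w x}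
  have hR : ∀ b ∈ t, b.2 ≤ (∫⁻ x, w x).toReal / a := by
    rintro b ⟨hb, hlt⟩
    rw [le_div_iff₀ ha, mul_comm]
    exact (ENNReal.ofReal_le_iff_le_toReal hw).1 (hlt.le.trans (setLIntegral_le_lintegral _ _))
  obtain ⟨u, hut, hdisj, hcov⟩ := Vitali.exists_disjoint_subfamily_covering_enlargement_ball t
    Prod.fst Prod.snd _ hR 5 (by norm_num)
  have hcount : u.Countable := hdisj.countable_of_isOpen (fun _ _ => Metric.isOpen_ball)
    (fun b hb => ⟨b.1, Metric.mem_ball_self (hut hb).1⟩)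
  have hsub : {y | ENNReal.ofReal a < hlMax w y} ⊆ ⋃ b ∈ u, Metric.ball b.1 (5 * b.2) := by
    intro y hy
    obtain ⟨ρ, hρ, h⟩ := exists_radius_of_lt_hlMax hy
    obtain ⟨b, hb, hsub⟩ := hcov (y, ρ) ⟨hρ, h⟩
    exact Set.mem_biUnion hb (hsub (Metric.mem_ball_self hρ))
  calc volume {y | ENNReal.ofReal a < hlMax w y}
      ≤ ∑' b : u, volume (Metric.ball b.1.1 (5 * b.1.2)) :=
        (measure_mono hsub).trans (measure_biUnion_le _ hcount _)
    _ ≤ ∑' b : u, ENNReal.ofReal (10 / a) * ∫⁻ x in Metric.ball b.1.1 b.1.2, w x := by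
        refine ENNReal.tsum_le_tsum fun b => ?_
        have hb := hut b.2
        rw [Real.volume_ball]
        calc ENNReal.ofReal (2 * (5 * b.1.2))
            = ENNReal.ofReal (10 / a) * ENNReal.ofReal (a * b.1.2) := by
              rw [← ENNReal.ofReal_mul (by positivity)]
              congr 1
              field_simp
              ring
          _ ≤ _ := mul_le_mul_right hb.2.le _
    _ = ENNReal.ofReal (10 / a) * ∫⁻ x in ⋃ b ∈ u, Metric.ball b.1 b.2, w x := by
        rw [ENNReal.tsum_mul_left,
          lintegral_biUnion hcount (fun _ _ => measurableSet_ball) hdisj]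
    _ ≤ _ := mul_le_mul_right (setLIntegral_le_lintegral _ _) _

theorem hlMax_le_hlMax_indicator_add (w : ℝ → ℝ≥0∞) (hw : Measurable w) (c y : ℝ) :
    hlMax w y ≤ hlMax ({x | ENNReal.ofReal c < w x}.indicator w) y + 2 * ENNReal.ofReal c := by
  refine iSup_le fun ρ => ?_
  have h0 : ENNReal.ofReal ρ.1 ≠ 0 := by simpa using ρ.2
  have hmeas : Measurable ({x | ENNReal.ofReal c < w x}.indicator w) :=
    hw.indicator (measurableSet_lt measurable_const hw)
  calc (ENNReal.ofReal ρ)⁻¹ * ∫⁻ x in Metric.ball y ρ, w x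
      ≤ (ENNReal.ofReal ρ)⁻¹ * ∫⁻ x in Metric.ball y ρ,
          ({x | ENNReal.ofReal c < w x}.indicator w x + ENNReal.ofReal c) := by
        gcongr with x
        by_cases h : ENNReal.ofReal c < w x
        · rw [Set.indicator_of_mem (by exact h)]
          exact le_self_add
        · exact (not_lt.1 h).trans le_add_self
    _ = ((ENNReal.ofReal ρ)⁻¹ *
          ∫⁻ x in Metric.ball y ρ, {x | ENNReal.ofReal c < w x}.indicator w x)
          + 2 * ENNReal.ofReal c := by
        rw [lintegral_add_left hmeas, mul_add, setLIntegral_const, Real.volume_ball,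
          ENNReal.ofReal_mul (by norm_num), ENNReal.ofReal_ofNat,
          mul_comm (2 : ℝ≥0∞) (ENNReal.ofReal _), mul_comm (ENNReal.ofReal c), mul_assoc, ← mul_assoc,
          ENNReal.inv_mul_cancel h0 ENNReal.ofReal_ne_top, one_mul]
    _ ≤ _ := by
        gcongr
        exact le_iSup (fun ρ : {ρ : ℝ // 0 < ρ} => (ENNReal.ofReal ρ)⁻¹ *
          ∫⁻ x in Metric.ball y ρ, {x | ENNReal.ofReal c < w x}.indicator w x) ρ

/-- The polynomially decaying bump `(1 + |z|)⁻ⁿ`. -/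
def bump (n : ℕ) (z : ℝ) : ℝ := ((1 + |z|) ^ n)⁻¹

theorem bump_pos (n : ℕ) (z : ℝ) : 0 < bump n z := by
  unfold bump
  positivity

theorem continuous_bump (n : ℕ) : Continuous (bump n) := by
  unfold bump
  exact Continuous.inv₀ (by fun_prop) fun z => by positivity

theorem bump_neg (n : ℕ) (z : ℝ) : bump n (-z) = bump n z := by simp [bump]

theorem bump_anti {n : ℕ} {y z : ℝ} (h : |y| ≤ |z|) : bump n z ≤ bump n y := by
  unfold bump
  gcongr

theorem bump_add (m n : ℕ) (z : ℝ) : bump (m + n) z = bump m z * bump n z := by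
  simp [bump, pow_add, mul_comm]

theorem bump_le_one (n : ℕ) (z : ℝ) : bump n z ≤ 1 := by
  unfold bump
  exact inv_le_one_of_one_le₀ (one_le_pow₀ (by linarith [abs_nonneg z]))

/-- Peetre-type inequality: the bump is slowly varying. -/
theorem bump_le_mul (n : ℕ) (y z : ℝ) : bump n y ≤ (1 + |y - z|) ^ n * bump n z := by
  unfold bump
  rw [← div_eq_mul_inv, le_div_iff₀ (by positivity), inv_mul_le_iff₀ (by positivity), ← mul_pow]
  gcongr
  have h1 : |z| ≤ |y| + |y - z| := by
    have := abs_sub_abs_le_abs_sub z y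
    rw [abs_sub_comm] at this
    linarith
  nlinarith [abs_nonneg y, abs_nonneg (y - z)]

theorem bump_two_le_tsum (u : ℝ) :
    ENNReal.ofReal (bump 2 u) ≤
      ∑' i : ℕ, ENNReal.ofReal (4 * (1 / 4) ^ i) * (Metric.ball (0 : ℝ) (2 ^ i)).indicator 1 u := by
  have hex : ∃ i : ℕ, |u| < 2 ^ i := pow_unbounded_of_one_lt _ (by norm_num)
  classical
  set i := Nat.find hex with hi
  have hlt : |u| < 2 ^ i := Nat.find_spec hex
  refine le_trans ?_ (ENNReal.le_tsum i)
  rw [Set.indicator_of_mem (by simpa using hlt), Pi.one_apply, mul_one]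
  refine ENNReal.ofReal_le_ofReal ?_
  rcases Nat.eq_zero_or_pos i with h0 | hpos
  · rw [h0]
    have := bump_le_one 2 u
    linarith
  · have hge : (2 : ℝ) ^ (i - 1) ≤ |u| := not_lt.1 (Nat.find_min hex (Nat.sub_lt hpos one_pos))
    have h2 : (2 : ℝ) ^ i ≤ 2 * (1 + |u|) := by
      obtain ⟨k, hk⟩ := Nat.exists_eq_succ_of_ne_zero hpos.ne'
      rw [hk] at hge ⊢
      simp only [Nat.succ_eq_add_one, Nat.add_sub_cancel] at hge
      rw [Nat.succ_eq_add_one, pow_succ]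
      linarith
    unfold bump
    rw [inv_le_iff_one_le_mul₀ (by positivity)]
    have h4 : ((1 : ℝ) / 4) ^ i * (2 ^ i) ^ 2 = 1 := by
      rw [← pow_mul, mul_comm i 2, pow_mul, ← mul_pow]
      norm_num
    calc (1 : ℝ) = (1 / 4) ^ i * (2 ^ i) ^ 2 := h4.symm
      _ ≤ (1 / 4) ^ i * (2 * (1 + |u|)) ^ 2 := by gcongr
      _ = _ := by ring

/-- The maximal function along the dyadic dilates of the bump `bump 2`. -/
def bumpMax (w : ℝ → ℝ≥0∞) (y : ℝ) : ℝ≥0∞ :=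
  ⨆ r : ℕ, ∫⁻ x, ENNReal.ofReal (2 ^ r * bump 2 (2 ^ r * (x - y))) * w x

theorem measurable_bumpMax {w : ℝ → ℝ≥0∞} (hw : Measurable w) : Measurable (bumpMax w) := by
  refine Measurable.iSup fun r => ?_
  have hb := (continuous_bump 2).measurable
  refine Measurable.lintegral_prod_right' (f := fun z : ℝ × ℝ =>
    ENNReal.ofReal (2 ^ r * bump 2 (2 ^ r * (z.2 - z.1))) * w z.2) ?_
  fun_prop

theorem bumpMax_le_hlMax {w : ℝ → ℝ≥0∞} (hw : Measurable w) (y : ℝ) :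
    bumpMax w y ≤ 8 * hlMax w y := by
  refine iSup_le fun r => ?_
  have hgeo : ∑' i : ℕ, ENNReal.ofReal (4 * (1 / 2) ^ i) = 8 := by
    rw [← ENNReal.ofReal_tsum_of_nonneg (fun _ => by positivity)
      ((summable_geometric_of_lt_one (by norm_num) (by norm_num)).mul_left 4), tsum_mul_left,
      tsum_geometric_of_lt_one (by norm_num) (by norm_num)]
    norm_num
  calc ∫⁻ x, ENNReal.ofReal (2 ^ r * bump 2 (2 ^ r * (x - y))) * w x
      ≤ ∫⁻ x, ∑' i : ℕ, ENNReal.ofReal (2 ^ r * (4 * (1 / 4) ^ i)) *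
          (Metric.ball y (2 ^ i / 2 ^ r)).indicator w x := by
        refine lintegral_mono fun x => ?_
        rw [ENNReal.ofReal_mul (by positivity), mul_assoc]
        have hmem : ∀ i : ℕ, (2 : ℝ) ^ r * (x - y) ∈ Metric.ball (0 : ℝ) (2 ^ i) ↔
            x ∈ Metric.ball y (2 ^ i / 2 ^ r) := fun i => by
          rw [mem_ball_zero_iff, Real.norm_eq_abs, Metric.mem_ball, Real.dist_eq, abs_mul,
            abs_of_pos (by positivity), lt_div_iff₀' (by positivity)]
        calc ENNReal.ofReal (2 ^ r) * (ENNReal.ofReal (bump 2 (2 ^ r * (x - y))) * w x)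
            ≤ ENNReal.ofReal (2 ^ r) * ((∑' i : ℕ, ENNReal.ofReal (4 * (1 / 4) ^ i) *
              (Metric.ball (0 : ℝ) (2 ^ i)).indicator 1 (2 ^ r * (x - y))) * w x) := by
              gcongr
              exact bump_two_le_tsum _
          _ = _ := by
              rw [← ENNReal.tsum_mul_right, ← ENNReal.tsum_mul_left]
              refine tsum_congr fun i => ?_
              rw [ENNReal.ofReal_mul (p := (2 : ℝ) ^ r) (by positivity)]
              by_cases h : x ∈ Metric.ball y (2 ^ i / 2 ^ r)
              · rw [Set.indicator_of_mem h, Set.indicator_of_mem ((hmem i).2 h), Pi.one_apply,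
                  mul_one, mul_assoc]
              · rw [Set.indicator_of_notMem h, Set.indicator_of_notMem (mt (hmem i).1 h)]
                simp
    _ = ∑' i : ℕ, ENNReal.ofReal (4 * (1 / 2) ^ i) *
          ((ENNReal.ofReal (2 ^ i / 2 ^ r))⁻¹ * ∫⁻ x in Metric.ball y (2 ^ i / 2 ^ r), w x) := by
        rw [lintegral_tsum fun i => ((hw.indicator measurableSet_ball).const_mul _).aemeasurable]
        refine tsum_congr fun i => ?_
        rw [lintegral_const_mul _ (hw.indicator measurableSet_ball),
          lintegral_indicator measurableSet_ball,
          ← mul_assoc (ENNReal.ofReal (4 * (1 / 2) ^ i)),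
          ← ENNReal.ofReal_inv_of_pos (by positivity), ← ENNReal.ofReal_mul (by positivity)]
        congr 2
        rw [inv_div, show (1 : ℝ) / 4 = 1 / 2 * (1 / 2) by norm_num, mul_pow]
        field_simp
        rw [← mul_pow]
        norm_num
    _ ≤ ∑' i : ℕ, ENNReal.ofReal (4 * (1 / 2) ^ i) * hlMax w y := by
        gcongr with i
        exact le_iSup (fun ρ : {ρ : ℝ // 0 < ρ} => (ENNReal.ofReal ρ)⁻¹ *
          ∫⁻ x in Metric.ball y ρ, w x) ⟨2 ^ i / 2 ^ r, by positivity⟩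
    _ = 8 * hlMax w y := by rw [ENNReal.tsum_mul_right, hgeo]

theorem hlMax_le_of_le {w : ℝ → ℝ≥0∞} {B : ℝ≥0∞} (hB : ∀ x, w x ≤ B) (y : ℝ) :
    hlMax w y ≤ 2 * B := by
  refine iSup_le fun ρ => ?_
  have h0 : ENNReal.ofReal ρ.1 ≠ 0 := by simpa using ρ.2
  calc (ENNReal.ofReal ρ)⁻¹ * ∫⁻ x in Metric.ball y ρ, w x
      ≤ (ENNReal.ofReal ρ)⁻¹ * ∫⁻ x in Metric.ball y ρ, B := by
        gcongr with x
        exact hB x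
    _ = 2 * B := by
        rw [setLIntegral_const, Real.volume_ball, ENNReal.ofReal_mul (by norm_num),
          ENNReal.ofReal_ofNat, mul_comm (2 : ℝ≥0∞) (ENNReal.ofReal _), mul_comm B, mul_assoc,
          ← mul_assoc, ENNReal.inv_mul_cancel h0 ENNReal.ofReal_ne_top, one_mul]

theorem bumpMax_le_of_le {w : ℝ → ℝ≥0∞} (hw : Measurable w) {B : ℝ≥0∞} (hB : ∀ x, w x ≤ B)
    (y : ℝ) : bumpMax w y ≤ 16 * B :=
  (bumpMax_le_hlMax hw y).trans ((mul_le_mul_right (hlMax_le_of_le hB y) _).trans_eq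
    (by rw [← mul_assoc]; norm_num))

theorem volume_lt_bumpMax_le {w : ℝ → ℝ≥0∞} (hw : Measurable w) {t : ℝ} (ht : 0 < t)
    (hfin : ∫⁻ x, {x | ENNReal.ofReal (t / 32) < w x}.indicator w x ≠ ∞) :
    volume {y | ENNReal.ofReal t < bumpMax w y} ≤
      ENNReal.ofReal (160 / t) * ∫⁻ x, {x | ENNReal.ofReal (t / 32) < w x}.indicator w x := by
  have h := volume_lt_hlMax_le hfin (a := t / 16) (by positivity)
  rw [show 10 / (t / 16) = 160 / t by field_simp; norm_num] at h
  refine (measure_mono fun y hy => ?_).trans h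
  by_contra hcon
  have h1 := not_lt.1 (show ¬ ENNReal.ofReal (t / 16) < hlMax _ y from hcon)
  refine absurd (show ENNReal.ofReal t < bumpMax w y from hy) (not_lt.2 ?_)
  calc bumpMax w y ≤ 8 * hlMax w y := bumpMax_le_hlMax hw y
    _ ≤ 8 * (ENNReal.ofReal (t / 16) + 2 * ENNReal.ofReal (t / 32)) := by
        gcongr
        exact (hlMax_le_hlMax_indicator_add w hw (t / 32) y).trans (by gcongr)
    _ = ENNReal.ofReal t := by
        rw [← ENNReal.ofReal_ofNat 2, ← ENNReal.ofReal_ofNat 8, ← ENNReal.ofReal_mul (by norm_num),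
          ← ENNReal.ofReal_add (by positivity) (by positivity), ← ENNReal.ofReal_mul (by norm_num)]
        congr 1
        ring

theorem lintegral_Ioo_rpow {s : ℝ} (hs : 1 < s) {v : ℝ} (hv : 0 ≤ v) :
    ∫⁻ t in Set.Ioo 0 v, ENNReal.ofReal (t ^ (s - 2)) =
      ENNReal.ofReal (v ^ (s - 1) / (s - 1)) := by
  have hInt : IntegrableOn (fun t : ℝ => t ^ (s - 2)) (Set.Ioo 0 v) :=
    ((intervalIntegral.intervalIntegrable_rpow' (a := 0) (b := v) (by linarith)).1).mono_set
      Set.Ioo_subset_Ioc_self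
  rw [← ofReal_integral_eq_lintegral_ofReal hInt, ← integral_Ioc_eq_integral_Ioo,
    ← intervalIntegral.integral_of_le hv, integral_rpow (Or.inl (by linarith))]
  · rw [show s - 2 + 1 = s - 1 by ring, Real.zero_rpow (by linarith), sub_zero]
  · filter_upwards [ae_restrict_mem measurableSet_Ioo] with t ht
    exact Real.rpow_nonneg ht.1.le _

/-- `L^s` boundedness of the maximal function, `s > 1`, tested on bounded functions. -/
theorem lintegral_bumpMax_rpow_le {s : ℝ} (hs : 1 < s) :
    ∃ C : ℝ≥0∞, C ≠ ∞ ∧ ∀ w : ℝ → ℝ≥0∞, Measurable w → ∀ B : ℝ≥0∞, B ≠ ∞ → (∀ x, w x ≤ B) →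
      ∫⁻ y, bumpMax w y ^ s ≤ C * ∫⁻ x, w x ^ s := by
  have hs1 : 0 < s - 1 := by linarith
  refine ⟨ENNReal.ofReal (s * (160 * (32 ^ (s - 1) / (s - 1)))), ENNReal.ofReal_ne_top,
    fun w hw B hB hwB => ?_⟩
  have hwfin : ∀ x, w x ≠ ∞ := fun x => ne_top_of_le_ne_top hB (hwB x)
  by_cases htop : ∫⁻ x, w x ^ s = ∞
  · rw [htop, ENNReal.mul_top]
    · exact le_top
    · rw [Ne, ENNReal.ofReal_eq_zero, not_le]
      positivity
  have hfin : ∀ t : ℝ, 0 < t →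
      ∫⁻ x, {x | ENNReal.ofReal (t / 32) < w x}.indicator w x ≠ ∞ := by
    intro t ht
    set c := ENNReal.ofReal (t / 32) with hc
    have hc0 : c ≠ 0 := by
      rw [hc, Ne, ENNReal.ofReal_eq_zero, not_le]
      positivity
    have hcs0 : c ^ (s - 1) ≠ 0 := fun h => by
      rcases ENNReal.rpow_eq_zero_iff.1 h with h | h
      · exact hc0 h.1
      · linarith [h.2]
    have hcst : c ^ (s - 1) ≠ ∞ := ENNReal.rpow_ne_top_of_nonneg hs1.le ENNReal.ofReal_ne_top
    refine ne_top_of_le_ne_top (b := (c ^ (s - 1))⁻¹ * ∫⁻ x, w x ^ s)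
      (ENNReal.mul_ne_top (ENNReal.inv_ne_top.2 hcs0) htop) ?_
    rw [← lintegral_const_mul _ (hw.pow_const s)]
    refine lintegral_mono fun x => ?_
    by_cases h : c < w x
    · rw [Set.indicator_of_mem (by exact h)]
      have hsplit : w x ^ s = w x ^ (s - 1) * w x := by
        conv_rhs => rw [← ENNReal.rpow_one (w x), ← ENNReal.rpow_mul, one_mul]
        rw [← ENNReal.rpow_add _ _ (ne_bot_of_gt h) (hwfin x), sub_add_cancel]
      rw [hsplit, ← mul_assoc]
      refine le_mul_of_one_le_left (zero_le) ?_
      rw [← ENNReal.inv_mul_cancel hcs0 hcst]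
      gcongr
    · rw [Set.indicator_of_notMem (by exact h)]
      exact zero_le
  have hFfin : ∀ y, bumpMax w y ≠ ∞ := fun y =>
    ne_top_of_le_ne_top (ENNReal.mul_ne_top (by norm_num) hB) (bumpMax_le_of_le hw hwB y)
  have hlay := lintegral_rpow_eq_lintegral_meas_lt_mul (volume : Measure ℝ)
    (f := fun y => (bumpMax w y).toReal) (Filter.Eventually.of_forall fun _ => ENNReal.toReal_nonneg)
    (measurable_bumpMax hw).ennreal_toReal.aemeasurable (p := s) (by linarith)
  have hleft : ∫⁻ y, bumpMax w y ^ s = ∫⁻ y, ENNReal.ofReal ((bumpMax w y).toReal ^ s) := by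
    refine lintegral_congr fun y => ?_
    rw [← ENNReal.ofReal_rpow_of_nonneg ENNReal.toReal_nonneg (by linarith),
      ENNReal.ofReal_toReal (hFfin y)]
  rw [hleft, hlay, ENNReal.ofReal_mul (by linarith), mul_assoc]
  gcongr
  calc ∫⁻ t in Set.Ioi (0 : ℝ), volume {a | t < (bumpMax w a).toReal} * ENNReal.ofReal (t ^ (s - 1))
      ≤ ∫⁻ t in Set.Ioi (0 : ℝ), ∫⁻ x, ENNReal.ofReal (160 * t ^ (s - 2)) *
          {x | ENNReal.ofReal (t / 32) < w x}.indicator w x := by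
        refine setLIntegral_mono' measurableSet_Ioi fun t ht => ?_
        have ht0 : (0 : ℝ) < t := ht
        rw [lintegral_const_mul _ (hw.indicator (measurableSet_lt measurable_const hw))]
        have hset : {a | t < (bumpMax w a).toReal} = {y | ENNReal.ofReal t < bumpMax w y} := by
          ext y
          exact (ENNReal.ofReal_lt_iff_lt_toReal ht0.le (hFfin y)).symm
        rw [hset]
        calc _ ≤ ENNReal.ofReal (160 / t) *
              (∫⁻ x, {x | ENNReal.ofReal (t / 32) < w x}.indicator w x) *
                ENNReal.ofReal (t ^ (s - 1)) := by
              gcongr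
              exact volume_lt_bumpMax_le hw ht0 (hfin t ht0)
          _ = _ := by
              rw [mul_right_comm, ← ENNReal.ofReal_mul (by positivity)]
              congr 2
              rw [show s - 1 = s - 2 + 1 by ring, Real.rpow_add_one ht0.ne']
              field_simp
    _ = ∫⁻ x, ∫⁻ t in Set.Ioi (0 : ℝ), ENNReal.ofReal (160 * t ^ (s - 2)) *
          {x | ENNReal.ofReal (t / 32) < w x}.indicator w x := by
        refine lintegral_lintegral_swap (Measurable.aemeasurable ?_)
        have hS : MeasurableSet {z : ℝ × ℝ | ENNReal.ofReal (z.1 / 32) < w z.2} :=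
          measurableSet_lt (by fun_prop) (by fun_prop)
        have hmeas : Measurable
            ({z : ℝ × ℝ | ENNReal.ofReal (z.1 / 32) < w z.2}.indicator fun z => w z.2) :=
          Measurable.indicator (by fun_prop) hS
        exact Measurable.mul (by fun_prop) hmeas
    _ = ∫⁻ x, ENNReal.ofReal (160 * (32 ^ (s - 1) / (s - 1))) * w x ^ s := by
        refine lintegral_congr fun x => ?_
        have hv : 0 ≤ 32 * (w x).toReal := by positivity
        have hset : ∀ t ∈ Set.Ioi (0 : ℝ), ENNReal.ofReal (160 * t ^ (s - 2)) *
            {x | ENNReal.ofReal (t / 32) < w x}.indicator w x =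
            (ENNReal.ofReal 160 * w x) * (Set.Ioo 0 (32 * (w x).toReal)).indicator
              (fun t => ENNReal.ofReal (t ^ (s - 2))) t := by
          intro t ht
          have ht0 : (0 : ℝ) < t := ht
          have hiff : ENNReal.ofReal (t / 32) < w x ↔ t ∈ Set.Ioo 0 (32 * (w x).toReal) := by
            rw [ENNReal.ofReal_lt_iff_lt_toReal (by positivity) (hwfin x), div_lt_iff₀ (by norm_num),
              mul_comm]
            exact ⟨fun h => ⟨ht0, h⟩, fun h => h.2⟩
          by_cases h : ENNReal.ofReal (t / 32) < w x
          · rw [Set.indicator_of_mem (by exact h), Set.indicator_of_mem (hiff.1 h),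
              ENNReal.ofReal_mul (by norm_num), mul_right_comm]
          · rw [Set.indicator_of_notMem (by exact h), Set.indicator_of_notMem (mt hiff.2 h)]
            simp
        rw [setLIntegral_congr_fun measurableSet_Ioi hset,
          lintegral_const_mul _ (Measurable.indicator (by fun_prop) measurableSet_Ioo),
          setLIntegral_indicator measurableSet_Ioo,
          Set.inter_eq_left.2 fun t ht => ht.1, lintegral_Ioo_rpow hs hv,
          Real.mul_rpow (by norm_num) ENNReal.toReal_nonneg]
        conv_rhs => rw [← ENNReal.ofReal_toReal (hwfin x)]
        conv_lhs => rw [← ENNReal.ofReal_toReal (hwfin x)]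
        rw [ENNReal.toReal_ofReal ENNReal.toReal_nonneg,
          ENNReal.ofReal_rpow_of_nonneg ENNReal.toReal_nonneg (by linarith),
          ← ENNReal.ofReal_mul (by norm_num), ← ENNReal.ofReal_mul (by positivity),
          ← ENNReal.ofReal_mul (by positivity)]
        congr 1
        have hsplit : (w x).toReal ^ s = (w x).toReal ^ (s - 1) * (w x).toReal := by
          conv_rhs => rw [← Real.rpow_one (w x).toReal, ← Real.rpow_mul ENNReal.toReal_nonneg,
            one_mul]
          rw [← Real.rpow_add_of_nonneg ENNReal.toReal_nonneg hs1.le zero_le_one, sub_add_cancel]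
        rw [hsplit]
        ring
    _ = _ := lintegral_const_mul _ (hw.pow_const s)

/-! ### Weighted Jensen inequality and duality for `[0, ∞]`-valued functions -/

theorem rpow_lintegral_mul_le {α : Type*} [MeasurableSpace α] (μ : Measure α) {q : ℝ} (hq : 1 < q)
    {κ f : α → ℝ≥0∞} (hκ : AEMeasurable κ μ) (hf : AEMeasurable f μ) :
    (∫⁻ x, κ x * f x ∂μ) ^ q ≤ (∫⁻ x, κ x ∂μ) ^ (q - 1) * ∫⁻ x, κ x * f x ^ q ∂μ := by
  have hq0 : 0 < q := by linarith
  have hconj : (q / (q - 1)).HolderConjugate q := (Real.HolderConjugate.conjExponent hq).symm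
  have h := ENNReal.lintegral_mul_le_Lp_mul_Lq μ hconj
    (f := fun x => κ x ^ ((q - 1) / q)) (g := fun x => κ x ^ (1 / q) * f x)
    (hκ.pow_const _) ((hκ.pow_const _).mul hf)
  have h1 : ∀ x, κ x ^ ((q - 1) / q) * (κ x ^ (1 / q) * f x) = κ x * f x := fun x => by
    rw [← mul_assoc, ← ENNReal.rpow_add_of_nonneg _ _ (div_nonneg (by linarith) hq0.le)
      (by positivity), ← add_div, sub_add_cancel, div_self hq0.ne', ENNReal.rpow_one]
  have h2 : ∀ x, (κ x ^ ((q - 1) / q)) ^ (q / (q - 1)) = κ x := fun x => by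
    rw [← ENNReal.rpow_mul, div_mul_div_comm, mul_comm, div_self, ENNReal.rpow_one]
    exact mul_ne_zero hq0.ne' (by linarith)
  have h3 : ∀ x, (κ x ^ (1 / q) * f x) ^ q = κ x * f x ^ q := fun x => by
    rw [ENNReal.mul_rpow_of_nonneg _ _ hq0.le, ← ENNReal.rpow_mul, one_div_mul_cancel hq0.ne',
      ENNReal.rpow_one]
  simp only [Pi.mul_apply, h1, h2, h3] at h
  calc _ ≤ _ := ENNReal.rpow_le_rpow h hq0.le
    _ = _ := by
      rw [ENNReal.mul_rpow_of_nonneg _ _ hq0.le, ← ENNReal.rpow_mul, ← ENNReal.rpow_mul,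
        one_div_mul_cancel hq0.ne', ENNReal.rpow_one]
      congr 2
      field_simp

theorem rpow_tsum_mul_le {ι : Type*} [Countable ι] {q : ℝ} (hq : 1 < q) (κ f : ι → ℝ≥0∞) :
    (∑' i, κ i * f i) ^ q ≤ (∑' i, κ i) ^ (q - 1) * ∑' i, κ i * f i ^ q := by
  let _ : MeasurableSpace ι := ⊤
  have h := rpow_lintegral_mul_le (Measure.count : Measure ι) hq (κ := κ) (f := f)
    (measurable_from_top).aemeasurable (measurable_from_top).aemeasurable
  simpa only [lintegral_count] using h

theorem tsum_rpow_le_rpow_tsum {ι : Type*} {q : ℝ} (hq : 1 < q) (a : ι → ℝ≥0∞) :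
    ∑' i, a i ^ q ≤ (∑' i, a i) ^ q := by
  have hsplit : ∀ x : ℝ≥0∞, x ^ q = x * x ^ (q - 1) := fun x => by
    conv_rhs => rw [← ENNReal.rpow_one x, ← ENNReal.rpow_mul, one_mul]
    rw [← ENNReal.rpow_add_of_nonneg _ _ zero_le_one (by linarith), add_sub_cancel]
  rw [hsplit (∑' i, a i), ← ENNReal.tsum_mul_right]
  refine ENNReal.tsum_le_tsum fun i => ?_
  rw [hsplit]
  exact mul_le_mul_right (ENNReal.rpow_le_rpow (ENNReal.le_tsum i) (by linarith)) _

/-- If `F` is bounded as a functional on bounded elements of `L^{r'}`, then `F ∈ L^r`. -/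
theorem lintegral_rpow_le_of_forall_lintegral_mul_le {r r' : ℝ} (hr : r.HolderConjugate r')
    {F : ℝ → ℝ≥0∞} (hF : Measurable F) {A : ℝ≥0∞}
    (h : ∀ w : ℝ → ℝ≥0∞, Measurable w → ∀ B : ℝ≥0∞, B ≠ ∞ → (∀ x, w x ≤ B) →
      ∫⁻ x, F x * w x ≤ A * (∫⁻ x, w x ^ r') ^ (1 / r')) :
    ∫⁻ x, F x ^ r ≤ A ^ r := by
  have hr1 : 1 < r := hr.lt
  have hr0 : 0 < r := by linarith
  let Fn : ℕ → ℝ → ℝ≥0∞ := fun n =>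
    (Metric.closedBall (0 : ℝ) n).indicator fun x => min (F x) n
  have hFn : ∀ n, Measurable (Fn n) := fun n =>
    (hF.min measurable_const).indicator measurableSet_closedBall
  have hle : ∀ n x, Fn n x ≤ F x := fun n x =>
    (Set.indicator_le_self' (fun _ _ => zero_le) x).trans (min_le_left _ _)
  have hlen : ∀ n x, Fn n x ≤ n := fun n x =>
    (Set.indicator_le_self' (fun _ _ => zero_le) x).trans (min_le_right _ _)
  have hpow : ∀ n x, Fn n x ^ r = Fn n x * Fn n x ^ (r - 1) := fun n x => by
    conv_rhs => rw [← ENNReal.rpow_one (Fn n x), ← ENNReal.rpow_mul, one_mul]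
    rw [← ENNReal.rpow_add_of_nonneg _ _ zero_le_one (by linarith), add_sub_cancel]
  have hconj : (r - 1) * r' = r := by
    have := hr.sub_one_mul_conj
    linarith
  have hfin : ∀ n, ∫⁻ x, Fn n x ^ r ≠ ∞ := fun n => by
    refine ne_top_of_le_ne_top (b := (n : ℝ≥0∞) ^ r * volume (Metric.closedBall (0 : ℝ) n)) ?_ ?_
    · exact ENNReal.mul_ne_top (ENNReal.rpow_ne_top_of_nonneg hr0.le (ENNReal.natCast_ne_top n))
        measure_closedBall_lt_top.ne
    · rw [← setLIntegral_const, ← lintegral_indicator measurableSet_closedBall]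
      refine lintegral_mono fun x => ?_
      by_cases hx : x ∈ Metric.closedBall (0 : ℝ) n
      · rw [Set.indicator_of_mem hx]
        exact ENNReal.rpow_le_rpow (hlen n x) hr0.le
      · simp only [Fn, Set.indicator_of_notMem hx]
        rw [ENNReal.zero_rpow_of_pos hr0]
  have hbound : ∀ n, ∫⁻ x, Fn n x ^ r ≤ A ^ r := fun n => by
    set I := ∫⁻ x, Fn n x ^ r with hI
    have h1 : I ≤ A * I ^ (1 / r') := by
      calc I ≤ ∫⁻ x, F x * Fn n x ^ (r - 1) := by
            refine lintegral_mono fun x => ?_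
            rw [hpow]
            gcongr
            exact hle n x
        _ ≤ A * (∫⁻ x, (Fn n x ^ (r - 1)) ^ r') ^ (1 / r') :=
            h _ ((hFn n).pow_const _) ((n : ℝ≥0∞) ^ (r - 1))
              (ENNReal.rpow_ne_top_of_nonneg (by linarith) (ENNReal.natCast_ne_top n))
              fun x => ENNReal.rpow_le_rpow (hlen n x) (by linarith)
        _ = _ := by simp only [← ENNReal.rpow_mul, hconj, hI]
    rcases eq_or_ne I 0 with h0 | h0
    · rw [h0]
      exact zero_le
    have hJ0 : I ^ (1 / r') ≠ 0 := fun h => by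
      rcases ENNReal.rpow_eq_zero_iff.1 h with h | h
      · exact h0 h.1
      · exact hfin n h.1
    have hJt : I ^ (1 / r') ≠ ∞ :=
      ENNReal.rpow_ne_top_of_nonneg (one_div_nonneg.2 hr.symm.nonneg) (hfin n)
    have h2 : I ^ (1 / r) ≤ A := by
      have : I = I ^ (1 / r) * I ^ (1 / r') := by
        rw [← ENNReal.rpow_add _ _ h0 (hfin n), one_div, one_div, hr.inv_add_inv_eq_one,
          ENNReal.rpow_one]
      rw [this] at h1
      exact (ENNReal.mul_le_mul_iff_left hJ0 hJt).1 (by rwa [← this] at h1 ⊢)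
    calc I = (I ^ (1 / r)) ^ r := by
          rw [← ENNReal.rpow_mul, one_div_mul_cancel hr0.ne', ENNReal.rpow_one]
      _ ≤ A ^ r := ENNReal.rpow_le_rpow h2 hr0.le
  have hlim : Filter.Tendsto (fun n => ∫⁻ x, Fn n x ^ r) Filter.atTop
      (nhds (∫⁻ x, F x ^ r)) := by
    refine lintegral_tendsto_of_tendsto_of_monotone (fun n => ((hFn n).pow_const r).aemeasurable)
      (Filter.Eventually.of_forall fun x n m hnm => ?_) (Filter.Eventually.of_forall fun x => ?_)
    · refine ENNReal.rpow_le_rpow ?_ hr0.le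
      have hnm' : (n : ℝ) ≤ m := by exact_mod_cast hnm
      refine (Set.indicator_le_indicator_of_subset (Metric.closedBall_subset_closedBall hnm')
        (fun _ => zero_le) x).trans (Set.indicator_le_indicator ?_)
      gcongr
    · suffices hFx : Filter.Tendsto (fun n => Fn n x) Filter.atTop (nhds (F x)) from
        ((ENNReal.continuous_rpow_const).tendsto (F x)).comp hFx
      have ht : Filter.Tendsto (fun n : ℕ => min (F x) (n : ℝ≥0∞)) Filter.atTop
          (nhds (min (F x) ∞)) :=
        (tendsto_const_nhds).min ENNReal.tendsto_nat_nhds_top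
      rw [min_top_right] at ht
      refine ht.congr' ?_
      obtain ⟨n₀, hn₀⟩ := exists_nat_ge |x|
      filter_upwards [Filter.eventually_ge_atTop n₀] with n hn
      have hn' : (n₀ : ℝ) ≤ n := by exact_mod_cast hn
      have hx : x ∈ Metric.closedBall (0 : ℝ) (n : ℝ) :=
        mem_closedBall_zero_iff.2 ((Real.norm_eq_abs x).trans_le (hn₀.trans hn'))
      simp [Fn, Set.indicator_of_mem hx]
  exact le_of_tendsto' hlim hbound

/-! ### Positive operators adapted to a dyadic lattice -/

/-- The points of the lattice `2^{-j-1} ℤ`. -/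
def latticePt (j : ℕ) (ν : ℤ) : ℝ := ν * (1 / 2 ^ (j + 1))

/-- The mass-normalized dyadic dilate of `bump 4`. -/
def dilBump (m : ℕ) (z : ℝ) : ℝ≥0∞ := ENNReal.ofReal (2 ^ m * bump 4 (2 ^ m * z))

/-- Averages at scale `2^{-m}` around the points of `2^{-j-1} ℤ`, averaged at scale `2^{-l}`. -/
def latticeOp (l j m : ℕ) (G : ℝ → ℝ≥0∞) (x : ℝ) : ℝ≥0∞ :=
  ∑' ν : ℤ, ENNReal.ofReal (1 / 2 ^ j) * dilBump l (x - latticePt j ν) *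
    ∫⁻ y, dilBump m (y - latticePt j ν) * G y

theorem measurable_dilBump (m : ℕ) : Measurable (dilBump m) := by
  have := (continuous_bump 4).measurable
  unfold dilBump
  fun_prop

theorem lintegral_bump_two_le (m : ℕ) (b : ℝ) :
    ∫⁻ y, ENNReal.ofReal (2 ^ m * bump 2 (2 ^ m * (y - b))) ≤ 16 := by
  have h := bumpMax_le_of_le (w := fun _ => 1) measurable_const (B := 1) (fun _ => le_rfl) b
  rw [mul_one] at h
  refine le_trans ?_ h
  refine le_trans (le_of_eq ?_) (le_iSup _ m)
  simp

theorem bump_four_le_bump_two (z : ℝ) : bump 4 z ≤ bump 2 z := by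
  rw [bump_add 2 2]
  exact mul_le_of_le_one_left (bump_pos 2 z).le (bump_le_one 2 z)

theorem lintegral_dilBump_le (m : ℕ) (b : ℝ) : ∫⁻ y, dilBump m (y - b) ≤ 16 := by
  refine (lintegral_mono fun y => ENNReal.ofReal_le_ofReal ?_).trans (lintegral_bump_two_le m b)
  gcongr
  exact bump_four_le_bump_two _

theorem tsum_lattice_bump_two_le {l j : ℕ} (hlj : l ≤ j) (x : ℝ) :
    ∑' ν : ℤ, ENNReal.ofReal (2 ^ l / 2 ^ j * bump 2 (2 ^ l * (x - latticePt j ν))) ≤ 128 := by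
  set c : ℝ := 1 / 2 ^ (j + 1) with hc
  have hcpos : 0 < c := by positivity
  have hterm : ∀ ν : ℤ, ENNReal.ofReal (2 ^ l / 2 ^ j * bump 2 (2 ^ l * (x - latticePt j ν))) ≤
      8 * ∫⁻ t in Set.Ico (ν • c) ((ν + 1) • c),
        ENNReal.ofReal (2 ^ l * bump 2 (2 ^ l * (t - x))) := by
    intro ν
    calc ENNReal.ofReal (2 ^ l / 2 ^ j * bump 2 (2 ^ l * (x - latticePt j ν)))
        = 8 * ∫⁻ t in Set.Ico (ν • c) ((ν + 1) • c),
            ENNReal.ofReal (2 ^ l / 4 * bump 2 (2 ^ l * (x - latticePt j ν))) := by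
          rw [setLIntegral_const, Real.volume_Ico, ← sub_smul, add_sub_cancel_left, one_smul,
            ← ENNReal.ofReal_mul (mul_nonneg (by positivity) (bump_pos _ _).le),
            ← ENNReal.ofReal_ofNat 8, ← ENNReal.ofReal_mul (by norm_num), hc]
          congr 1
          field_simp
          ring
      _ ≤ _ := by
          refine mul_le_mul_right (setLIntegral_mono' measurableSet_Ico fun t ht => ?_) _
          refine ENNReal.ofReal_le_ofReal ?_
          have h1 := bump_le_mul 2 (2 ^ l * (x - latticePt j ν)) (2 ^ l * (x - t))
          have h2 : bump 2 (2 ^ l * (x - t)) = bump 2 (2 ^ l * (t - x)) := by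
            rw [← bump_neg]
            congr 1
            ring
          have h3 : |2 ^ l * (x - latticePt j ν) - 2 ^ l * (x - t)| ≤ 1 := by
            have hb : latticePt j ν = ν • c := by rw [zsmul_eq_mul, latticePt]
            rw [← mul_sub, abs_mul, abs_of_pos (by positivity),
              show x - latticePt j ν - (x - t) = t - ν • c by rw [hb]; ring,
              abs_of_nonneg (by linarith [ht.1])]
            have h4 : t - ν • c ≤ c := by
              have := ht.2
              rw [add_smul, one_smul] at this
              linarith
            calc (2 : ℝ) ^ l * (t - ν • c) ≤ 2 ^ (j + 1) * c := by
                  have h5 := ht.1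
                  exact mul_le_mul (pow_le_pow_right₀ one_le_two (hlj.trans (Nat.le_succ j))) h4
                    (by linarith) (by positivity)
              _ = 1 := by rw [hc]; field_simp
          rw [h2] at h1
          have h5 : (1 + |2 ^ l * (x - latticePt j ν) - 2 ^ l * (x - t)|) ^ 2 ≤ (4 : ℝ) := by
            nlinarith [abs_nonneg (2 ^ l * (x - latticePt j ν) - 2 ^ l * (x - t))]
          have h6 := bump_pos 2 (2 ^ l * (t - x))
          calc (2 : ℝ) ^ l / 4 * bump 2 (2 ^ l * (x - latticePt j ν))
              ≤ 2 ^ l / 4 * (4 * bump 2 (2 ^ l * (t - x))) := by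
                gcongr
                exact h1.trans (by gcongr)
            _ = _ := by ring
  calc _ ≤ _ := ENNReal.tsum_le_tsum hterm
    _ = 8 * ∫⁻ t in ⋃ ν : ℤ, Set.Ico (ν • c) ((ν + 1) • c),
          ENNReal.ofReal (2 ^ l * bump 2 (2 ^ l * (t - x))) := by
        rw [ENNReal.tsum_mul_left,
          lintegral_iUnion (fun _ => measurableSet_Ico) (Set.pairwise_disjoint_Ico_zsmul c)]
    _ ≤ 8 * 16 := mul_le_mul_right ((setLIntegral_le_lintegral _ _).trans
          (lintegral_bump_two_le l x)) _
    _ = 128 := by norm_num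

theorem abs_two_pow_mul (n : ℕ) (z : ℝ) : |2 ^ n * z| = 2 ^ n * |z| := by
  rw [abs_mul, abs_of_pos (by positivity)]

theorem tsum_lattice_bump_two_le_pow (m j : ℕ) (x : ℝ) :
    ∑' ν : ℤ, ENNReal.ofReal (2 ^ m / 2 ^ j * bump 2 (2 ^ m * (x - latticePt j ν))) ≤
      128 * ENNReal.ofReal (2 ^ (m - j)) := by
  rcases le_total m j with h | h
  · rw [Nat.sub_eq_zero_of_le h, pow_zero, ENNReal.ofReal_one, mul_one]
    exact tsum_lattice_bump_two_le h x
  · calc _ ≤ ∑' ν : ℤ, ENNReal.ofReal (2 ^ j / 2 ^ j * bump 2 (2 ^ j * (x - latticePt j ν))) *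
          ENNReal.ofReal (2 ^ (m - j)) := by
          refine ENNReal.tsum_le_tsum fun ν => ?_
          rw [← ENNReal.ofReal_mul (mul_nonneg (by positivity) (bump_pos _ _).le)]
          refine ENNReal.ofReal_le_ofReal ?_
          rw [div_self (by positivity), one_mul, mul_comm (bump _ _),
            show (2 : ℝ) ^ m / 2 ^ j = 2 ^ (m - j) by
              rw [pow_sub₀ _ two_ne_zero h, div_eq_mul_inv]]
          gcongr
          refine bump_anti ?_
          rw [abs_two_pow_mul, abs_two_pow_mul]
          gcongr
          exact one_le_two
      _ ≤ _ := by
          rw [ENNReal.tsum_mul_right]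
          gcongr
          exact tsum_lattice_bump_two_le le_rfl x

theorem bump_mul_bump_le {l m : ℕ} (hlm : l ≤ m) (u v : ℝ) :
    bump 4 (2 ^ l * u) * bump 4 (2 ^ m * v) ≤
      bump 2 (2 ^ l * (u - v)) * bump 2 (2 ^ m * v) := by
  have h1 := bump_le_mul 2 (2 ^ l * u) (2 ^ l * (u - v))
  rw [show (2 : ℝ) ^ l * u - 2 ^ l * (u - v) = 2 ^ l * v by ring] at h1
  have h2 : (1 + |2 ^ l * v|) ^ 2 * bump 2 (2 ^ m * v) ≤ 1 := by
    unfold bump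
    rw [← div_eq_mul_inv, div_le_one (by positivity), abs_two_pow_mul, abs_two_pow_mul]
    gcongr
    exact one_le_two
  have h3 := bump_pos 2 (2 ^ l * (u - v))
  have h4 := bump_pos 2 (2 ^ m * v)
  calc bump 4 (2 ^ l * u) * bump 4 (2 ^ m * v)
      ≤ (1 + |2 ^ l * v|) ^ 2 * bump 2 (2 ^ l * (u - v)) *
          (bump 2 (2 ^ m * v) * bump 2 (2 ^ m * v)) := by
        rw [← bump_add]
        exact mul_le_mul_of_nonneg_right ((bump_four_le_bump_two _).trans h1) (bump_pos _ _).le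
    _ = ((1 + |2 ^ l * v|) ^ 2 * bump 2 (2 ^ m * v)) *
          (bump 2 (2 ^ l * (u - v)) * bump 2 (2 ^ m * v)) := by ring
    _ ≤ _ := mul_le_of_le_one_left (by positivity) h2

theorem tsum_dilBump_mul_dilBump_le {l j : ℕ} (hlj : l ≤ j) (m : ℕ) (x y : ℝ) :
    ∑' ν : ℤ, ENNReal.ofReal (1 / 2 ^ j) * dilBump l (x - latticePt j ν) *
        dilBump m (y - latticePt j ν) ≤
      128 * ENNReal.ofReal (2 ^ (m - j)) *
        ENNReal.ofReal (2 ^ min l m * bump 2 (2 ^ min l m * (x - y))) := by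
  have hmul : ∀ ν, ENNReal.ofReal (1 / 2 ^ j) * dilBump l (x - latticePt j ν) *
      dilBump m (y - latticePt j ν) = ENNReal.ofReal (1 / 2 ^ j * (2 ^ l * 2 ^ m) *
        (bump 4 (2 ^ l * (x - latticePt j ν)) * bump 4 (2 ^ m * (y - latticePt j ν)))) := by
    intro ν
    have h1 := bump_pos 4 (2 ^ l * (x - latticePt j ν))
    rw [dilBump, dilBump, ← ENNReal.ofReal_mul (by positivity),
      ← ENNReal.ofReal_mul (by positivity)]
    congr 1
    ring
  simp only [hmul]
  rcases le_total l m with h | h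
  · rw [min_eq_left h]
    calc _ ≤ ∑' ν : ℤ, ENNReal.ofReal (2 ^ m / 2 ^ j * bump 2 (2 ^ m * (y - latticePt j ν))) *
          ENNReal.ofReal (2 ^ l * bump 2 (2 ^ l * (x - y))) := by
          refine ENNReal.tsum_le_tsum fun ν => ?_
          rw [← ENNReal.ofReal_mul (mul_nonneg (by positivity) (bump_pos _ _).le)]
          refine ENNReal.ofReal_le_ofReal ?_
          have h2 := bump_mul_bump_le h (x - latticePt j ν) (y - latticePt j ν)
          rw [sub_sub_sub_cancel_right] at h2
          calc _ ≤ 1 / 2 ^ j * (2 ^ l * 2 ^ m) *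
                (bump 2 (2 ^ l * (x - y)) * bump 2 (2 ^ m * (y - latticePt j ν))) := by gcongr
            _ = _ := by ring
      _ ≤ _ := by
          rw [ENNReal.tsum_mul_right]
          gcongr
          exact tsum_lattice_bump_two_le_pow m j y
  · rw [min_eq_right h, Nat.sub_eq_zero_of_le (h.trans hlj), pow_zero, ENNReal.ofReal_one, mul_one]
    calc _ ≤ ∑' ν : ℤ, ENNReal.ofReal (2 ^ l / 2 ^ j * bump 2 (2 ^ l * (x - latticePt j ν))) *
          ENNReal.ofReal (2 ^ m * bump 2 (2 ^ m * (x - y))) := by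
          refine ENNReal.tsum_le_tsum fun ν => ?_
          rw [← ENNReal.ofReal_mul (mul_nonneg (by positivity) (bump_pos _ _).le)]
          refine ENNReal.ofReal_le_ofReal ?_
          have h2 := bump_mul_bump_le h (y - latticePt j ν) (x - latticePt j ν)
          rw [sub_sub_sub_cancel_right, ← bump_neg, ← mul_neg, neg_sub,
            mul_comm (bump 4 _)] at h2
          have h3 : bump 4 (2 ^ m * (y - latticePt j ν)) =
            bump 4 (2 ^ m * (latticePt j ν - y)) := by
            rw [← bump_neg, ← mul_neg, neg_sub]
          have h4 : bump 2 (2 ^ m * (y - x)) = bump 2 (2 ^ m * (x - y)) := by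
            rw [← bump_neg, ← mul_neg, neg_sub]
          calc _ ≤ 1 / 2 ^ j * (2 ^ l * 2 ^ m) *
                (bump 2 (2 ^ m * (x - y)) * bump 2 (2 ^ l * (x - latticePt j ν))) := by
                refine mul_le_mul_of_nonneg_left ?_ (by positivity)
                simpa only [h3, h4] using h2
            _ = _ := by ring
      _ ≤ _ := by
          rw [ENNReal.tsum_mul_right]
          gcongr
          exact tsum_lattice_bump_two_le hlj x

theorem measurable_latticeOp (l j m : ℕ) (G : ℝ → ℝ≥0∞) : Measurable (latticeOp l j m G) := by
  refine Measurable.tsum fun ν => ?_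
  have := measurable_dilBump l
  fun_prop

theorem rpow_latticeOp_le {q : ℝ} (hq : 1 < q) {l j : ℕ} (hlj : l ≤ j) (m : ℕ)
    {G : ℝ → ℝ≥0∞} (hG : Measurable G) (x : ℝ) :
    latticeOp l j m G x ^ q ≤ (128 * 16) ^ (q - 1) * latticeOp l j m (fun y => G y ^ q) x := by
  have hq1 : 0 ≤ q - 1 := by linarith
  have hmass : ∑' ν : ℤ, ENNReal.ofReal (1 / 2 ^ j) * dilBump l (x - latticePt j ν) ≤ 128 := by
    refine (ENNReal.tsum_le_tsum fun ν => ?_).trans (tsum_lattice_bump_two_le hlj x)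
    rw [dilBump, ← ENNReal.ofReal_mul (by positivity)]
    refine ENNReal.ofReal_le_ofReal ?_
    calc _ = 2 ^ l / 2 ^ j * bump 4 (2 ^ l * (x - latticePt j ν)) := by ring
      _ ≤ _ := by
        gcongr
        exact bump_four_le_bump_two _
  have hinner : ∀ ν : ℤ, (∫⁻ y, dilBump m (y - latticePt j ν) * G y) ^ q ≤
      16 ^ (q - 1) * ∫⁻ y, dilBump m (y - latticePt j ν) * G y ^ q := fun ν => by
    have hm := measurable_dilBump m
    refine (rpow_lintegral_mul_le volume hq (κ := fun y => dilBump m (y - latticePt j ν))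
      (by fun_prop) hG.aemeasurable).trans ?_
    gcongr
    exact lintegral_dilBump_le m _
  calc latticeOp l j m G x ^ q
      ≤ 128 ^ (q - 1) * ∑' ν : ℤ, ENNReal.ofReal (1 / 2 ^ j) * dilBump l (x - latticePt j ν) *
          (16 ^ (q - 1) * ∫⁻ y, dilBump m (y - latticePt j ν) * G y ^ q) := by
        refine (rpow_tsum_mul_le hq _ _).trans ?_
        gcongr with ν
        exact hinner ν
    _ = _ := by
        rw [ENNReal.mul_rpow_of_nonneg _ _ hq1]
        simp only [latticeOp, ← ENNReal.tsum_mul_left]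
        exact tsum_congr fun ν => by ring

theorem lintegral_latticeOp_mul_le {l j : ℕ} (hlj : l ≤ j) (m : ℕ) {H w : ℝ → ℝ≥0∞}
    (hH : Measurable H) (hw : Measurable w) :
    ∫⁻ x, latticeOp l j m H x * w x ≤
      128 * ENNReal.ofReal (2 ^ (m - j)) * ∫⁻ y, H y * bumpMax w y := by
  have hl := measurable_dilBump l
  have hm := measurable_dilBump m
  have hb := (continuous_bump 2).measurable
  calc ∫⁻ x, latticeOp l j m H x * w x
      = ∫⁻ x, ∫⁻ y, (∑' ν : ℤ, ENNReal.ofReal (1 / 2 ^ j) * dilBump l (x - latticePt j ν) *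
          dilBump m (y - latticePt j ν)) * (H y * w x) := by
        refine lintegral_congr fun x => ?_
        rw [latticeOp, ← ENNReal.tsum_mul_right]
        simp only [← ENNReal.tsum_mul_right]
        rw [lintegral_tsum fun ν => by fun_prop]
        refine tsum_congr fun ν => ?_
        rw [mul_right_comm, ← lintegral_const_mul _ (by fun_prop)]
        refine lintegral_congr fun y => ?_
        ring
    _ ≤ ∫⁻ x, ∫⁻ y, 128 * ENNReal.ofReal (2 ^ (m - j)) *
        ENNReal.ofReal (2 ^ min l m * bump 2 (2 ^ min l m * (x - y))) * (H y * w x) := by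
        gcongr with x y
        exact tsum_dilBump_mul_dilBump_le hlj m x y
    _ = ∫⁻ y, ∫⁻ x, 128 * ENNReal.ofReal (2 ^ (m - j)) *
        ENNReal.ofReal (2 ^ min l m * bump 2 (2 ^ min l m * (x - y))) * (H y * w x) :=
        lintegral_lintegral_swap (by fun_prop)
    _ = ∫⁻ y, 128 * ENNReal.ofReal (2 ^ (m - j)) * (H y *
        ∫⁻ x, ENNReal.ofReal (2 ^ min l m * bump 2 (2 ^ min l m * (x - y))) * w x) := by
        refine lintegral_congr fun y => ?_
        rw [← mul_assoc, ← lintegral_const_mul _ (by fun_prop)]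
        refine lintegral_congr fun x => ?_
        ring
    _ ≤ ∫⁻ y, 128 * ENNReal.ofReal (2 ^ (m - j)) * (H y * bumpMax w y) := by
        gcongr with y
        exact le_iSup (fun r : ℕ => ∫⁻ x, ENNReal.ofReal (2 ^ r * bump 2 (2 ^ r * (x - y))) * w x)
          (min l m)
    _ = _ := lintegral_const_mul _ (hH.mul (measurable_bumpMax hw))

theorem lintegral_latticeOp_rpow_mul_le {q : ℝ} (hq : 1 < q) {l j : ℕ} (hlj : l ≤ j) (m : ℕ)
    {G w : ℝ → ℝ≥0∞} (hG : Measurable G) (hw : Measurable w) :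
    ∫⁻ x, latticeOp l j m G x ^ q * w x ≤ (128 * 16) ^ (q - 1) * 128 *
      (ENNReal.ofReal (2 ^ (m - j)) * ∫⁻ y, G y ^ q * bumpMax w y) := by
  calc _ ≤ ∫⁻ x, (128 * 16) ^ (q - 1) * (latticeOp l j m (fun y => G y ^ q) x * w x) := by
        refine lintegral_mono fun x => ?_
        rw [← mul_assoc]
        gcongr
        exact rpow_latticeOp_le hq hlj m hG x
    _ ≤ _ := by
        have hS := measurable_latticeOp l j m (fun y => G y ^ q)
        rw [lintegral_const_mul _ (by fun_prop)]
        refine (mul_le_mul_right (lintegral_latticeOp_mul_le hlj m (hG.pow_const q) hw) _).trans_eq ?_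
        ring

/-- Exponential off-diagonal decay. -/
def decay (δ : ℝ) (k j : ℕ) : ℝ≥0∞ := ENNReal.ofReal (2 ^ (-(δ * |(k : ℝ) - j|)))

theorem decay_comm (δ : ℝ) (k j : ℕ) : decay δ k j = decay δ j k := by
  rw [decay, decay, abs_sub_comm]

theorem exists_tsum_decay_le {δ : ℝ} (hδ : 0 < δ) :
    ∃ C : ℝ≥0∞, C ≠ ∞ ∧ ∀ j, ∑' k, decay δ k j ≤ C := by
  refine ⟨∑' n : ℤ, ENNReal.ofReal (2 ^ (-(δ * |(n : ℝ)|))), ?_, fun j => ?_⟩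
  · have hgeo : Summable fun n : ℕ => (2 : ℝ) ^ (-(δ * |((n : ℤ) : ℝ)|)) := by
      have h1 : (2 : ℝ) ^ (-δ) < 1 := Real.rpow_lt_one_of_one_lt_of_neg one_lt_two (by linarith)
      refine (summable_geometric_of_lt_one (by positivity) h1).congr fun n => ?_
      rw [← Real.rpow_natCast, ← Real.rpow_mul two_pos.le]
      simp
    refine Summable.tsum_ofReal_ne_top (Summable.of_nat_of_neg hgeo ?_)
    exact hgeo.congr fun n => by simp
  · have hinj : Function.Injective fun k : ℕ => (k : ℤ) - j := fun a b h => by simpa using h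
    refine le_trans (le_of_eq (tsum_congr fun k => ?_))
      (ENNReal.tsum_comp_le_tsum_of_injective hinj _)
    rw [decay]
    push_cast
    rfl

/-- The discrete model operator dominating the Littlewood-Paley pieces of a Haar projection. -/
def haarModel (H : Finset ℕ) (δ q : ℝ) (G : ℕ → ℝ → ℝ≥0∞) (k : ℕ) (x : ℝ) : ℝ≥0∞ :=
  ∑' i : H × ℕ, decay δ k i.1 * (ENNReal.ofReal (2 ^ (-((i.1 - i.2 : ℕ) : ℝ))) *
    (ENNReal.ofReal (2 ^ (-(((i.2 - i.1 : ℕ) : ℝ) / q))) *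
      latticeOp (min k i.1) i.1 i.2 (G i.2) x))

/-- Indicator that `j` lies in the window of radius `N` around `m - iN`. -/
def window (N i m j : ℕ) : ℝ≥0∞ := if |(j : ℤ) - (m - i * N)| ≤ N then 1 else 0

/-- Near-diagonal weight. -/
def nearWeight (K N j m : ℕ) : ℝ≥0∞ :=
  if m ≤ j + K * N then ENNReal.ofReal (2 ^ (-((j - m : ℕ) : ℝ))) else 0

theorem nearWeight_le {N : ℕ} (hN : 1 ≤ N) (K j m : ℕ) :
    nearWeight K N j m ≤ decay 1 j m + ∑ i ∈ Finset.range (K + 1), window N i m j := by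
  unfold nearWeight
  split_ifs with h
  · rcases le_total m j with hmj | hmj
    · refine le_trans (le_of_eq ?_) le_self_add
      rw [decay, Nat.cast_sub hmj, one_mul, abs_of_nonneg]
      have : (m : ℝ) ≤ j := by exact_mod_cast hmj
      linarith
    · have hi : (m - j) / N ∈ Finset.range (K + 1) := by
        rw [Finset.mem_range, Nat.lt_succ_iff]
        exact Nat.div_le_of_le_mul (by rw [mul_comm]; omega)
      have h1 : window N ((m - j) / N) m j = 1 := by
        refine if_pos ?_
        have h2 := Nat.div_add_mod (m - j) N
        have h3 := Nat.mod_lt (m - j) (Nat.pos_of_ne_zero (by omega) : 0 < N)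
        have h4 : (((m - j) / N : ℕ) : ℤ) * N = m - j - ((m - j) % N : ℕ) := by
          have : ((N * ((m - j) / N) + (m - j) % N : ℕ) : ℤ) = ((m - j : ℕ) : ℤ) := by rw [h2]
          push_cast [Nat.cast_sub hmj] at this ⊢
          linarith
        rw [h4, abs_le]
        constructor <;> omega
      calc _ ≤ (1 : ℝ≥0∞) := by
            rw [Nat.sub_eq_zero_of_le hmj]
            simp
        _ = window N ((m - j) / N) m j := h1.symm
        _ ≤ _ := (Finset.single_le_sum (f := fun i => window N i m j)
              (fun _ _ => zero_le) hi).trans le_add_self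
  · exact zero_le

theorem tsum_window_le (N i j : ℕ) : ∑' m, window N i m j ≤ 2 * N + 1 := by
  have hsub : {m : ℕ | |(j : ℤ) - (m - i * N)| ≤ N} ⊆
      ((Finset.Icc ((j : ℤ) + i * N - N) (j + i * N + N)).image Int.toNat : Finset ℕ) := by
    intro m hm
    rw [Set.mem_ofPred_eq, abs_le] at hm
    rw [Finset.coe_image]
    refine ⟨m, ?_, by simp⟩
    rw [Finset.mem_coe, Finset.mem_Icc]
    constructor <;> linarith
  have hcard : ((Finset.Icc ((j : ℤ) + i * N - N) (j + i * N + N)).image Int.toNat).card ≤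
      2 * N + 1 := by
    refine Finset.card_image_le.trans ?_
    rw [Int.card_Icc]
    omega
  set T := (Finset.Icc ((j : ℤ) + i * N - N) (j + i * N + N)).image Int.toNat
  rw [tsum_eq_sum (s := T)]
  · calc ∑ m ∈ T, window N i m j ≤ ∑ m ∈ T, 1 := by
          refine Finset.sum_le_sum fun m _ => ?_
          unfold window
          split_ifs <;> simp
      _ = (T.card : ℝ≥0∞) := by simp
      _ ≤ _ := by exact_mod_cast hcard
  · intro m hm
    exact if_neg fun h => hm (by exact_mod_cast hsub h)

theorem sum_window_le {H : Finset ℕ} {N Z : ℕ}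
    (hZ : ∀ k : ℤ, (H.filter fun j : ℕ => |(j : ℤ) - k| ≤ N).card ≤ Z) (i m : ℕ) :
    ∑ j ∈ H, window N i m j ≤ Z := by
  unfold window
  rw [Finset.sum_boole]
  exact_mod_cast hZ (m - i * N)

/-- Row and column sums of the near-diagonal weight. -/
theorem exists_nearWeight_sum_le (K : ℕ) : ∃ C : ℝ≥0∞, C ≠ ∞ ∧ ∀ (N : ℕ), 1 ≤ N →
    (∀ j, ∑' m, nearWeight K N j m ≤ C * N) ∧
    ∀ (H : Finset ℕ) (Z : ℕ), 1 ≤ Z →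
      (∀ k : ℤ, (H.filter fun j : ℕ => |(j : ℤ) - k| ≤ N).card ≤ Z) →
      ∀ m, ∑ j ∈ H, nearWeight K N j m ≤ C * Z := by
  obtain ⟨D, hD, hdecay⟩ := exists_tsum_decay_le one_pos
  refine ⟨D + (K + 1) * 3, by finiteness, fun N hN => ⟨fun j => ?_, fun H Z hZ1 hZ m => ?_⟩⟩
  · have hN' : (1 : ℝ≥0∞) ≤ N := by exact_mod_cast hN
    calc ∑' m, nearWeight K N j m
        ≤ ∑' m, (decay 1 m j + ∑ i ∈ Finset.range (K + 1), window N i m j) :=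
          ENNReal.tsum_le_tsum fun m => decay_comm 1 m j ▸ nearWeight_le hN K j m
      _ = ∑' m, decay 1 m j + ∑ i ∈ Finset.range (K + 1), ∑' m, window N i m j := by
          rw [ENNReal.tsum_add, Summable.tsum_finsetSum fun _ _ => ENNReal.summable]
      _ ≤ D + ∑ i ∈ Finset.range (K + 1), (2 * N + 1 : ℝ≥0∞) :=
          add_le_add (hdecay j) (Finset.sum_le_sum fun i _ => tsum_window_le N i j)
      _ = D * 1 + (K + 1) * (2 * N + 1) := by simp [mul_add]
      _ ≤ D * N + (K + 1) * (2 * N + N) := by gcongr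
      _ = _ := by ring
  · have hZ' : (1 : ℝ≥0∞) ≤ Z := by exact_mod_cast hZ1
    calc ∑ j ∈ H, nearWeight K N j m
        ≤ ∑ j ∈ H, (decay 1 j m + ∑ i ∈ Finset.range (K + 1), window N i m j) :=
          Finset.sum_le_sum fun j _ => nearWeight_le hN K j m
      _ = ∑ j ∈ H, decay 1 j m + ∑ i ∈ Finset.range (K + 1), ∑ j ∈ H, window N i m j := by
          rw [Finset.sum_add_distrib, Finset.sum_comm]
      _ ≤ D + ∑ i ∈ Finset.range (K + 1), (Z : ℝ≥0∞) :=
          add_le_add ((ENNReal.sum_le_tsum H).trans (hdecay m))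
            (Finset.sum_le_sum fun i _ => sum_window_le hZ i m)
      _ = D * 1 + (K + 1) * (1 * Z) := by simp
      _ ≤ D * Z + (K + 1) * (3 * Z) := by
          gcongr
          norm_num
      _ = _ := by ring

theorem lintegral_mul_latticeOp_rpow_mul_le {q : ℝ} (hq : 1 < q) {l j : ℕ} (hlj : l ≤ j) (m : ℕ)
    {G w : ℝ → ℝ≥0∞} (hG : Measurable G) (hw : Measurable w) :
    ∫⁻ x, (ENNReal.ofReal (2 ^ (-(((m - j : ℕ) : ℝ) / q))) * latticeOp l j m G x) ^ q * w x ≤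
      (128 * 16) ^ (q - 1) * 128 * ∫⁻ y, G y ^ q * bumpMax w y := by
  have hq0 : 0 < q := by linarith
  have h1 : ENNReal.ofReal (2 ^ (-(((m - j : ℕ) : ℝ) / q))) ^ q * ENNReal.ofReal (2 ^ (m - j)) =
      1 := by
    rw [ENNReal.ofReal_rpow_of_nonneg (by positivity) hq0.le, ← Real.rpow_mul two_pos.le,
      neg_mul, div_mul_cancel₀ _ hq0.ne', ← ENNReal.ofReal_mul (by positivity),
      Real.rpow_neg two_pos.le, Real.rpow_natCast, inv_mul_cancel₀ (by positivity),
      ENNReal.ofReal_one]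
  have hL := measurable_latticeOp l j m G
  calc _ = ENNReal.ofReal (2 ^ (-(((m - j : ℕ) : ℝ) / q))) ^ q *
        ∫⁻ x, latticeOp l j m G x ^ q * w x := by
        rw [← lintegral_const_mul _ (by fun_prop)]
        simp_rw [ENNReal.mul_rpow_of_nonneg _ _ hq0.le, mul_assoc]
    _ ≤ ENNReal.ofReal (2 ^ (-(((m - j : ℕ) : ℝ) / q))) ^ q * ((128 * 16) ^ (q - 1) * 128 *
          (ENNReal.ofReal (2 ^ (m - j)) * ∫⁻ y, G y ^ q * bumpMax w y)) := by
        gcongr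
        exact lintegral_latticeOp_rpow_mul_le hq hlj m hG hw
    _ = ENNReal.ofReal (2 ^ (-(((m - j : ℕ) : ℝ) / q))) ^ q * ENNReal.ofReal (2 ^ (m - j)) *
          ((128 * 16) ^ (q - 1) * 128 * ∫⁻ y, G y ^ q * bumpMax w y) := by ring
    _ = _ := by rw [h1, one_mul]

theorem lintegral_mul_latticeOp_rpow_le {q : ℝ} (hq : 1 < q) {l j : ℕ} (hlj : l ≤ j) (m : ℕ)
    {G : ℝ → ℝ≥0∞} (hG : Measurable G) :
    ∫⁻ x, (ENNReal.ofReal (2 ^ (-(((m - j : ℕ) : ℝ) / q))) * latticeOp l j m G x) ^ q ≤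
      (128 * 16) ^ (q - 1) * 128 * 16 * ∫⁻ y, G y ^ q := by
  have h := lintegral_mul_latticeOp_rpow_mul_le hq hlj m hG (w := fun _ => 1) measurable_const
  simp only [mul_one] at h
  refine h.trans ?_
  rw [mul_assoc _ 16, ← lintegral_const_mul 16 (hG.pow_const q)]
  gcongr _ * ?_
  refine lintegral_mono fun y => ?_
  rw [mul_comm]
  gcongr
  simpa using bumpMax_le_of_le (w := fun _ => 1) measurable_const (B := 1) (fun _ => le_rfl) y

/-- The near-diagonal part of `haarModel`. -/
def nearModel (H : Finset ℕ) (δ q : ℝ) (K N : ℕ) (G : ℕ → ℝ → ℝ≥0∞) (k : ℕ) (x : ℝ) : ℝ≥0∞ :=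
  ∑' i : H × ℕ, decay δ k i.1 * nearWeight K N i.1 i.2 *
    (ENNReal.ofReal (2 ^ (-(((i.2 - i.1 : ℕ) : ℝ) / q))) *
      latticeOp (min k i.1) i.1 i.2 (G i.2) x)

theorem measurable_nearModel (H : Finset ℕ) (δ q : ℝ) (K N : ℕ) (G : ℕ → ℝ → ℝ≥0∞) (k : ℕ) :
    Measurable (nearModel H δ q K N G k) := by
  refine Measurable.tsum fun i => ?_
  have := measurable_latticeOp (min k i.1) i.1 i.2 (G i.2)
  fun_prop

theorem exists_lintegral_nearModel_mul_le {δ q : ℝ} (hδ : 0 < δ) (hq : 1 < q) (K : ℕ) :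
    ∃ C : ℝ≥0∞, C ≠ ∞ ∧ ∀ (N : ℕ), 1 ≤ N → ∀ (H : Finset ℕ) (Z : ℕ), 1 ≤ Z →
      (∀ k : ℤ, (H.filter fun j : ℕ => |(j : ℤ) - k| ≤ N).card ≤ Z) →
      ∀ (G : ℕ → ℝ → ℝ≥0∞), (∀ m, Measurable (G m)) → ∀ w : ℝ → ℝ≥0∞, Measurable w →
      ∫⁻ x, (∑' k, nearModel H δ q K N G k x ^ q) * w x ≤
        C * ((N : ℝ≥0∞) ^ (q - 1) * Z) * ∫⁻ y, (∑' m, G m y ^ q) * bumpMax w y := by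
  obtain ⟨A, hA, hdecay⟩ := exists_tsum_decay_le hδ
  obtain ⟨B, hB, hnear⟩ := exists_nearWeight_sum_le K
  have hq1 : 0 ≤ q - 1 := by linarith
  have hq0 : 0 < q := by linarith
  set D : ℝ≥0∞ := (128 * 16) ^ (q - 1) * 128 with hDdef
  have hD : D ≠ ∞ := ENNReal.mul_ne_top (ENNReal.rpow_ne_top_of_nonneg hq1 (by finiteness))
    (by finiteness)
  refine ⟨(A * B) ^ (q - 1) * D * A * B, ?_, fun N hN H Z hZ1 hZ G hG w hw => ?_⟩
  · have : (A * B) ^ (q - 1) ≠ ∞ := ENNReal.rpow_ne_top_of_nonneg hq1 (by finiteness)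
    finiteness
  obtain ⟨hrow, hcol⟩ := hnear N hN
  replace hcol := hcol H Z hZ1 hZ
  set κ : ℕ → H × ℕ → ℝ≥0∞ := fun k i => decay δ k i.1 * nearWeight K N i.1 i.2 with hκ
  set F : ℕ → H × ℕ → ℝ → ℝ≥0∞ := fun k i x =>
    ENNReal.ofReal (2 ^ (-(((i.2 - i.1 : ℕ) : ℝ) / q))) *
      latticeOp (min k i.1) i.1 i.2 (G i.2) x with hF
  have hFm : ∀ k i, Measurable (F k i) := fun k i =>
    (measurable_latticeOp (min k i.1) i.1 i.2 (G i.2)).const_mul _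
  have hmass : ∀ k, ∑' i, κ k i ≤ A * (B * N) := fun k => by
    rw [ENNReal.tsum_prod']
    calc ∑' j : H, ∑' m, decay δ k j * nearWeight K N j m
        = ∑' j : H, decay δ k j * ∑' m, nearWeight K N j m :=
          tsum_congr fun j => ENNReal.tsum_mul_left
      _ ≤ ∑' j : H, decay δ j k * (B * N) := by
          gcongr with j
          · rw [decay_comm]
          · exact hrow j
      _ = (∑' j : H, decay δ j k) * (B * N) := ENNReal.tsum_mul_right
      _ ≤ _ := by
          gcongr
          exact (ENNReal.tsum_comp_le_tsum_of_injective Subtype.val_injective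
            fun j => decay δ j k).trans (hdecay k)
  have hpt : ∀ k x, nearModel H δ q K N G k x ^ q ≤
      (A * (B * N)) ^ (q - 1) * ∑' i, κ k i * F k i x ^ q := fun k x => by
    refine (rpow_tsum_mul_le hq (κ k) fun i => F k i x).trans ?_
    gcongr
    exact hmass k
  have hFw : ∀ k i, ∫⁻ x, F k i x ^ q * w x ≤ D * ∫⁻ y, G i.2 y ^ q * bumpMax w y := fun k i =>
    lintegral_mul_latticeOp_rpow_mul_le hq (min_le_right _ _) i.2 (hG i.2) hw
  have hbm := measurable_bumpMax hw
  calc ∫⁻ x, (∑' k, nearModel H δ q K N G k x ^ q) * w x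
      ≤ ∫⁻ x, ∑' k, (A * (B * N)) ^ (q - 1) * ∑' i, κ k i * (F k i x ^ q * w x) := by
        refine lintegral_mono fun x => ?_
        rw [← ENNReal.tsum_mul_right]
        refine ENNReal.tsum_le_tsum fun k => ?_
        refine (mul_le_mul_left (hpt k x) _).trans_eq ?_
        rw [mul_assoc, ← ENNReal.tsum_mul_right]
        simp_rw [mul_assoc]
    _ = (A * (B * N)) ^ (q - 1) * ∑' k, ∑' i, κ k i * ∫⁻ x, F k i x ^ q * w x := by
        rw [lintegral_tsum fun k => by fun_prop, ← ENNReal.tsum_mul_left]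
        refine tsum_congr fun k => ?_
        rw [lintegral_const_mul _ (by fun_prop), lintegral_tsum fun i => by fun_prop]
        congr 1
        exact tsum_congr fun i => lintegral_const_mul _ (by fun_prop)
    _ ≤ (A * (B * N)) ^ (q - 1) * ∑' k, ∑' i, κ k i * (D * ∫⁻ y, G i.2 y ^ q * bumpMax w y) := by
        gcongr with k i
        exact hFw k i
    _ = (A * (B * N)) ^ (q - 1) * ∑' m, ∑' j : H, (∑' k, decay δ k j) *
          (nearWeight K N j m * (D * ∫⁻ y, G m y ^ q * bumpMax w y)) := by
        rw [ENNReal.tsum_comm, ENNReal.tsum_prod', ENNReal.tsum_comm]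
        congr 1
        refine tsum_congr fun m => tsum_congr fun j => ?_
        rw [← ENNReal.tsum_mul_right]
        exact tsum_congr fun k => mul_assoc _ _ _
    _ ≤ (A * (B * N)) ^ (q - 1) * ∑' m, ∑' j : H, A *
          (nearWeight K N j m * (D * ∫⁻ y, G m y ^ q * bumpMax w y)) := by
        gcongr with m j
        exact hdecay j
    _ = (A * (B * N)) ^ (q - 1) * ∑' m, A * ((∑ j ∈ H, nearWeight K N j m) *
          (D * ∫⁻ y, G m y ^ q * bumpMax w y)) := by
        congr 1
        refine tsum_congr fun m => ?_
        rw [ENNReal.tsum_mul_left, ENNReal.tsum_mul_right, tsum_fintype,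
          Finset.sum_coe_sort H fun j => nearWeight K N j m]
    _ ≤ (A * (B * N)) ^ (q - 1) * ∑' m, A * ((B * Z) *
          (D * ∫⁻ y, G m y ^ q * bumpMax w y)) := by
        gcongr with m
        exact hcol m
    _ = (A * B * N) ^ (q - 1) * (A * ((B * Z) * (D *
          ∫⁻ y, (∑' m, G m y ^ q) * bumpMax w y))) := by
        simp_rw [ENNReal.tsum_mul_left, ← ENNReal.tsum_mul_right]
        rw [lintegral_tsum fun m => by have := hG m; fun_prop, mul_assoc A B]
    _ = _ := by
        rw [ENNReal.mul_rpow_of_nonneg _ _ hq1]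
        ring

theorem exists_lintegral_nearModel_rpow_le {δ q p : ℝ} (hδ : 0 < δ) (hq : 1 < q) (hqp : q < p)
    (K : ℕ) :
    ∃ C : ℝ≥0∞, C ≠ ∞ ∧ ∀ (N : ℕ), 1 ≤ N → ∀ (H : Finset ℕ) (Z : ℕ), 1 ≤ Z →
      (∀ k : ℤ, (H.filter fun j : ℕ => |(j : ℤ) - k| ≤ N).card ≤ Z) →
      ∀ (G : ℕ → ℝ → ℝ≥0∞), (∀ m, Measurable (G m)) →
      ∫⁻ x, (∑' k, nearModel H δ q K N G k x ^ q) ^ (p / q) ≤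
        C * ((N : ℝ≥0∞) ^ (q - 1) * Z) ^ (p / q) * ∫⁻ y, (∑' m, G m y ^ q) ^ (p / q) := by
  obtain ⟨C, hC, hmain⟩ := exists_lintegral_nearModel_mul_le hδ hq K
  have hr : 1 < p / q := (one_lt_div (by linarith)).2 hqp
  have hr0 : 0 < p / q := by linarith
  have hconj := Real.HolderConjugate.conjExponent hr
  set r := p / q
  set r' := Real.conjExponent r
  have hr'0 : 0 < 1 / r' := one_div_pos.2 hconj.symm.pos
  obtain ⟨M, hM, hmax⟩ := lintegral_bumpMax_rpow_le hconj.symm.lt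
  have hM' : M ^ (1 / r') ≠ ∞ := ENNReal.rpow_ne_top_of_nonneg hr'0.le hM
  refine ⟨(C * M ^ (1 / r')) ^ r, ENNReal.rpow_ne_top_of_nonneg hr0.le (by finiteness),
    fun N hN H Z hZ1 hZ G hG => ?_⟩
  have hmeas : Measurable fun x => ∑' k, nearModel H δ q K N G k x ^ q :=
    Measurable.tsum fun k => (measurable_nearModel H δ q K N G k).pow_const q
  have hmeasG : Measurable fun x => ∑' m, G m x ^ q :=
    Measurable.tsum fun m => (hG m).pow_const q
  set Y : ℝ≥0∞ := ∫⁻ y, (∑' m, G m y ^ q) ^ r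
  have h := lintegral_rpow_le_of_forall_lintegral_mul_le hconj hmeas
    (A := C * M ^ (1 / r') * ((N : ℝ≥0∞) ^ (q - 1) * Z) * Y ^ (1 / r)) fun w hw B hB hwB => ?_
  · refine h.trans_eq ?_
    rw [ENNReal.mul_rpow_of_nonneg _ _ hr0.le, ENNReal.mul_rpow_of_nonneg _ _ hr0.le,
      ← ENNReal.rpow_mul Y, one_div_mul_cancel hr0.ne', ENNReal.rpow_one]
  · refine (hmain N hN H Z hZ1 hZ G hG w hw).trans ?_
    calc C * ((N : ℝ≥0∞) ^ (q - 1) * Z) * ∫⁻ y, (∑' m, G m y ^ q) * bumpMax w y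
        ≤ C * ((N : ℝ≥0∞) ^ (q - 1) * Z) *
            (Y ^ (1 / r) * (∫⁻ y, bumpMax w y ^ r') ^ (1 / r')) := by
          gcongr
          exact ENNReal.lintegral_mul_le_Lp_mul_Lq _ hconj hmeasG.aemeasurable
            (measurable_bumpMax hw).aemeasurable
      _ ≤ C * ((N : ℝ≥0∞) ^ (q - 1) * Z) *
            (Y ^ (1 / r) * (M * ∫⁻ y, w y ^ r') ^ (1 / r')) := by
          gcongr
          exact hmax w hw B hB hwB
      _ = _ := by
          rw [ENNReal.mul_rpow_of_nonneg _ _ hr'0.le]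
          ring

/-- Off-diagonal weight. -/
def farWeight (ε : ℝ) (K N j m : ℕ) : ℝ≥0∞ :=
  if m ≤ j + K * N then 0 else ENNReal.ofReal (2 ^ (-(((m - j : ℕ) : ℝ) * ε)))

theorem exists_tsum_farWeight_le {ε : ℝ} (hε : 0 < ε) {K : ℕ} (hK : 2 / ε ≤ K) :
    ∃ C : ℝ≥0∞, C ≠ ∞ ∧ ∀ N j : ℕ, ∑' m, farWeight ε K N j m ≤ C * ENNReal.ofReal (2 ^ N)⁻¹ := by
  obtain ⟨C, hC, hdecay⟩ := exists_tsum_decay_le (half_pos hε)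
  refine ⟨C, hC, fun N j => ?_⟩
  calc ∑' m, farWeight ε K N j m ≤ ∑' m, decay (ε / 2) m j * ENNReal.ofReal (2 ^ N)⁻¹ := by
        refine ENNReal.tsum_le_tsum fun m => ?_
        unfold farWeight
        split_ifs with h
        · exact zero_le
        · rw [decay, ← ENNReal.ofReal_mul (by positivity)]
          refine ENNReal.ofReal_le_ofReal ?_
          have hjm : j ≤ m := by
            have := Nat.zero_le (K * N)
            omega
          have h1 : (j : ℝ) + K * N ≤ m := by exact_mod_cast (not_le.1 h).le
          have h2 : (j : ℝ) ≤ m := by exact_mod_cast hjm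
          rw [Nat.cast_sub hjm, ← Real.rpow_natCast, ← Real.rpow_neg two_pos.le,
            ← Real.rpow_add two_pos, abs_of_nonneg (by linarith)]
          refine Real.rpow_le_rpow_of_exponent_le one_le_two ?_
          have h3 : (N : ℝ) * 2 ≤ K * N * ε := by
            rw [div_le_iff₀ hε] at hK
            nlinarith [Nat.cast_nonneg (α := ℝ) N]
          nlinarith
    _ = (∑' m, decay (ε / 2) m j) * ENNReal.ofReal (2 ^ N)⁻¹ := ENNReal.tsum_mul_right
    _ ≤ _ := by
        gcongr
        exact hdecay j

/-- The off-diagonal part of `haarModel`. -/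
def farModel (H : Finset ℕ) (δ ε p : ℝ) (K N : ℕ) (G : ℕ → ℝ → ℝ≥0∞) (k : ℕ) (x : ℝ) : ℝ≥0∞ :=
  ∑' i : H × ℕ, decay δ k i.1 * farWeight ε K N i.1 i.2 *
    (ENNReal.ofReal (2 ^ (-(((i.2 - i.1 : ℕ) : ℝ) / p))) *
      latticeOp (min k i.1) i.1 i.2 (G i.2) x)

theorem exists_lintegral_farModel_rpow_le {δ ε q p : ℝ} (hδ : 0 < δ) (hε : 0 < ε) (hq : 1 < q)
    (hqp : q < p) {K : ℕ} (hK : 2 / ε ≤ K) :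
    ∃ C : ℝ≥0∞, C ≠ ∞ ∧ ∀ (N : ℕ) (H : Finset ℕ), H.card ≤ 2 ^ N →
      ∀ (G : ℕ → ℝ → ℝ≥0∞), (∀ m, Measurable (G m)) →
      ∫⁻ x, (∑' k, farModel H δ ε p K N G k x ^ q) ^ (p / q) ≤
        C * ∫⁻ y, (∑' m, G m y ^ q) ^ (p / q) := by
  obtain ⟨A, hA, hdecay⟩ := exists_tsum_decay_le hδ
  obtain ⟨B, hB, hfar⟩ := exists_tsum_farWeight_le hε hK
  have hp : 1 < p := hq.trans hqp
  have hp1 : 0 ≤ p - 1 := by linarith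
  have hq0 : 0 < q := by linarith
  set D : ℝ≥0∞ := (128 * 16) ^ (p - 1) * 128 * 16 with hDdef
  have hD : D ≠ ∞ := by
    have : (128 * 16 : ℝ≥0∞) ^ (p - 1) ≠ ∞ := ENNReal.rpow_ne_top_of_nonneg hp1 (by finiteness)
    finiteness
  refine ⟨(A * B) ^ (p - 1) * ((A * B) * D), ?_, fun N H hH G hG => ?_⟩
  · have : (A * B) ^ (p - 1) ≠ ∞ := ENNReal.rpow_ne_top_of_nonneg hp1 (by finiteness)
    finiteness
  set κ : ℕ × (H × ℕ) → ℝ≥0∞ := fun i => decay δ i.1 i.2.1 * farWeight ε K N i.2.1 i.2.2 with hκ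
  set F : ℕ × (H × ℕ) → ℝ → ℝ≥0∞ := fun i x =>
    ENNReal.ofReal (2 ^ (-(((i.2.2 - i.2.1 : ℕ) : ℝ) / p))) *
      latticeOp (min i.1 i.2.1) i.2.1 i.2.2 (G i.2.2) x with hF
  have hFm : ∀ i, Measurable (F i) := fun i =>
    (measurable_latticeOp (min i.1 i.2.1) i.2.1 i.2.2 (G i.2.2)).const_mul _
  have hmass : ∑' i, κ i ≤ A * B := by
    rw [ENNReal.tsum_prod', ENNReal.tsum_comm, ENNReal.tsum_prod']
    calc ∑' j : H, ∑' m, ∑' k, decay δ k j * farWeight ε K N j m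
        = ∑' j : H, (∑' k, decay δ k j) * ∑' m, farWeight ε K N j m := by
          refine tsum_congr fun j => ?_
          rw [← ENNReal.tsum_mul_left]
          exact tsum_congr fun m => ENNReal.tsum_mul_right
      _ ≤ ∑' j : H, A * (B * ENNReal.ofReal (2 ^ N)⁻¹) := by
          gcongr with j
          · exact hdecay j
          · exact hfar N j
      _ = A * B * (H.card * ENNReal.ofReal (2 ^ N)⁻¹) := by
          rw [tsum_fintype, Finset.sum_const, Finset.card_univ, Fintype.card_coe, nsmul_eq_mul]
          ring
      _ ≤ A * B * 1 := by
          gcongr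
          calc (H.card : ℝ≥0∞) * ENNReal.ofReal (2 ^ N)⁻¹
              = ENNReal.ofReal (H.card * (2 ^ N)⁻¹) := by
                rw [ENNReal.ofReal_mul (by positivity), ENNReal.ofReal_natCast]
            _ ≤ ENNReal.ofReal 1 := by
                refine ENNReal.ofReal_le_ofReal ?_
                rw [← div_eq_mul_inv, div_le_one (by positivity)]
                exact_mod_cast hH
            _ = 1 := ENNReal.ofReal_one
      _ = _ := mul_one _
  have hG' : ∀ m, ∫⁻ y, G m y ^ p ≤ ∫⁻ y, (∑' m, G m y ^ q) ^ (p / q) := fun m => by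
    refine lintegral_mono fun y => ?_
    calc G m y ^ p = (G m y ^ q) ^ (p / q) := by
          rw [← ENNReal.rpow_mul, mul_div_cancel₀ _ hq0.ne']
      _ ≤ _ := ENNReal.rpow_le_rpow (ENNReal.le_tsum m) (by positivity)
  calc ∫⁻ x, (∑' k, farModel H δ ε p K N G k x ^ q) ^ (p / q)
      ≤ ∫⁻ x, (A * B) ^ (p - 1) * ∑' i, κ i * F i x ^ p := by
        refine lintegral_mono fun x => ?_
        calc (∑' k, farModel H δ ε p K N G k x ^ q) ^ (p / q)
            ≤ ((∑' k, farModel H δ ε p K N G k x) ^ q) ^ (p / q) :=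
              ENNReal.rpow_le_rpow (tsum_rpow_le_rpow_tsum hq _) (by positivity)
          _ = (∑' i, κ i * F i x) ^ p := by
              rw [← ENNReal.rpow_mul, mul_div_cancel₀ _ hq0.ne', ENNReal.tsum_prod']
              rfl
          _ ≤ (∑' i, κ i) ^ (p - 1) * ∑' i, κ i * F i x ^ p := rpow_tsum_mul_le hp _ _
          _ ≤ _ := by gcongr
    _ = (A * B) ^ (p - 1) * ∑' i, κ i * ∫⁻ x, F i x ^ p := by
        rw [lintegral_const_mul _ (by fun_prop), lintegral_tsum fun i => by fun_prop]
        congr 1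
        exact tsum_congr fun i => lintegral_const_mul _ (by fun_prop)
    _ ≤ (A * B) ^ (p - 1) * ∑' i, κ i * (D * ∫⁻ y, (∑' m, G m y ^ q) ^ (p / q)) := by
        gcongr with i
        refine (lintegral_mul_latticeOp_rpow_le hp (min_le_right _ _) i.2.2 (hG i.2.2)).trans ?_
        exact mul_le_mul_right (hG' i.2.2) _
    _ = (A * B) ^ (p - 1) * ((∑' i, κ i) * (D * ∫⁻ y, (∑' m, G m y ^ q) ^ (p / q))) := by
        rw [ENNReal.tsum_mul_right]
    _ ≤ (A * B) ^ (p - 1) * ((A * B) * (D * ∫⁻ y, (∑' m, G m y ^ q) ^ (p / q))) := by gcongr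
    _ = _ := by ring

theorem haarModel_eq_add (q p : ℝ) (H : Finset ℕ) (δ : ℝ) (K N : ℕ)
    (G : ℕ → ℝ → ℝ≥0∞) (k : ℕ) (x : ℝ) :
    haarModel H δ q G k x =
      nearModel H δ q K N G k x + farModel H δ (1 / q - 1 / p) p K N G k x := by
  rw [haarModel, nearModel, farModel, ← ENNReal.tsum_add]
  refine tsum_congr fun i => ?_
  unfold nearWeight farWeight
  split_ifs with h
  · rw [mul_zero, zero_mul, add_zero, mul_assoc]
  · have hji : (i.1 : ℕ) ≤ i.2 := by
      have := Nat.zero_le (K * N)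
      omega
    rw [mul_zero, zero_mul, zero_add, Nat.sub_eq_zero_of_le hji, Nat.cast_zero, neg_zero,
      Real.rpow_zero, ENNReal.ofReal_one, one_mul, mul_assoc, ← mul_assoc (ENNReal.ofReal _)
      (ENNReal.ofReal _), ← ENNReal.ofReal_mul (by positivity), ← Real.rpow_add two_pos]
    congr 5
    ring

/-- The vector-valued inequality for the discrete model operator. -/
theorem exists_lintegral_haarModel_rpow_le {δ q p : ℝ} (hδ : 0 < δ) (hq : 1 < q) (hqp : q < p) :
    ∃ C : ℝ≥0∞, C ≠ ∞ ∧ ∀ (N : ℕ), 1 ≤ N → ∀ (H : Finset ℕ), H.card ≤ 2 ^ N →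
      ∀ Z : ℕ, 1 ≤ Z → (∀ k : ℤ, (H.filter fun j : ℕ => |(j : ℤ) - k| ≤ N).card ≤ Z) →
      ∀ (G : ℕ → ℝ → ℝ≥0∞), (∀ m, Measurable (G m)) →
      ∫⁻ x, (∑' k, haarModel H δ q G k x ^ q) ^ (p / q) ≤
        C * ((N : ℝ≥0∞) ^ (q - 1) * Z) ^ (p / q) * ∫⁻ y, (∑' m, G m y ^ q) ^ (p / q) := by
  have hq0 : 0 < q := by linarith
  have hε : 0 < 1 / q - 1 / p := sub_pos.2 (one_div_lt_one_div_of_lt hq0 hqp)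
  obtain ⟨K, hK⟩ := exists_nat_ge (2 / (1 / q - 1 / p))
  obtain ⟨A, hA, hnear⟩ := exists_lintegral_nearModel_rpow_le hδ hq hqp K
  obtain ⟨B, hB, hfar⟩ := exists_lintegral_farModel_rpow_le hδ hε hq hqp hK
  have hr : 1 ≤ p / q := (one_le_div hq0).2 hqp.le
  have hr0 : 0 ≤ p / q := by linarith
  set T : ℝ≥0∞ := (2 ^ (q - 1)) ^ (p / q) * 2 ^ (p / q - 1) with hTdef
  have hT : T ≠ ∞ := ENNReal.mul_ne_top
    (ENNReal.rpow_ne_top_of_nonneg hr0 (ENNReal.rpow_ne_top_of_nonneg (by linarith) (by finiteness)))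
    (ENNReal.rpow_ne_top_of_nonneg (by linarith) (by finiteness))
  refine ⟨T * (A + B), by finiteness, fun N hN H hH Z hZ1 hZ G hG => ?_⟩
  set S := fun x => ∑' k, nearModel H δ q K N G k x ^ q
  set R := fun x => ∑' k, farModel H δ (1 / q - 1 / p) p K N G k x ^ q
  have hS : Measurable S :=
    Measurable.tsum fun k => (measurable_nearModel H δ q K N G k).pow_const q
  set Y := ∫⁻ y, (∑' m, G m y ^ q) ^ (p / q)
  have hNZ : (1 : ℝ≥0∞) ≤ ((N : ℝ≥0∞) ^ (q - 1) * Z) ^ (p / q) :=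
    ENNReal.one_le_rpow (one_le_mul (ENNReal.one_le_rpow (by exact_mod_cast hN) (by linarith))
      (by exact_mod_cast hZ1)) (by positivity)
  calc ∫⁻ x, (∑' k, haarModel H δ q G k x ^ q) ^ (p / q)
      ≤ ∫⁻ x, T * (S x ^ (p / q) + R x ^ (p / q)) := by
        refine lintegral_mono fun x => ?_
        calc (∑' k, haarModel H δ q G k x ^ q) ^ (p / q)
            ≤ (2 ^ (q - 1) * (S x + R x)) ^ (p / q) := by
              gcongr
              rw [← ENNReal.tsum_add, ← ENNReal.tsum_mul_left]
              refine ENNReal.tsum_le_tsum fun k => ?_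
              rw [haarModel_eq_add q p H δ K N G k x]
              exact ENNReal.rpow_add_le_mul_rpow_add_rpow _ _ hq.le
          _ = (2 ^ (q - 1)) ^ (p / q) * (S x + R x) ^ (p / q) :=
              ENNReal.mul_rpow_of_nonneg _ _ hr0
          _ ≤ (2 ^ (q - 1)) ^ (p / q) * (2 ^ (p / q - 1) * (S x ^ (p / q) + R x ^ (p / q))) := by
              gcongr
              exact ENNReal.rpow_add_le_mul_rpow_add_rpow _ _ hr
          _ = _ := by rw [hTdef, mul_assoc]
    _ = T * ((∫⁻ x, S x ^ (p / q)) + ∫⁻ x, R x ^ (p / q)) := by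
        rw [lintegral_const_mul' _ _ hT, lintegral_add_left (by fun_prop)]
    _ ≤ T * (A * ((N : ℝ≥0∞) ^ (q - 1) * Z) ^ (p / q) * Y +
          B * ((N : ℝ≥0∞) ^ (q - 1) * Z) ^ (p / q) * Y) := by
        gcongr
        · exact hnear N hN H Z hZ1 hZ G hG
        · refine (hfar N H hH G hG).trans ?_
          gcongr
          exact le_mul_of_one_le_right zero_le hNZ
    _ = _ := by ring

/-- The `L¹`-normalized dyadic dilate of a kernel. -/
def dil (k : ℕ) (Ψ : ℝ → ℂ) (z : ℝ) : ℂ := (2 : ℂ) ^ k * Ψ ((2 : ℝ) ^ k * z)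

theorem norm_dil (k : ℕ) (Ψ : ℝ → ℂ) (z : ℝ) : ‖dil k Ψ z‖ = 2 ^ k * ‖Ψ (2 ^ k * z)‖ := by
  simp [dil]

theorem latticePt_add (j : ℕ) (ν i : ℤ) :
    latticePt j (ν + i) = latticePt j ν + i * (1 / 2 ^ (j + 1)) := by
  simp [latticePt, add_mul]

theorem haarFn_eq (j : ℕ) (μ : ℤ) (x : ℝ) : haarFn j μ x =
    (Set.Ico (latticePt j (2 * μ)) (latticePt j (2 * μ + 1))).indicator (fun _ => (1 : ℂ)) x -
    (Set.Ico (latticePt j (2 * μ + 1)) (latticePt j (2 * μ + 2))).indicator (fun _ => (1 : ℂ)) x := by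
  have h0 : (2 : ℝ) ^ (-(j : ℤ)) * μ = latticePt j (2 * μ) := by
    rw [latticePt, zpow_neg, zpow_natCast]
    push_cast
    field_simp
    ring
  have h1 : (2 : ℝ) ^ (-(j : ℤ)) * (μ + 1 / 2) = latticePt j (2 * μ + 1) := by
    rw [latticePt, zpow_neg, zpow_natCast]
    push_cast
    field_simp
    ring
  have h2 : (2 : ℝ) ^ (-(j : ℤ)) * (μ + 1) = latticePt j (2 * μ + 2) := by
    rw [latticePt, zpow_neg, zpow_natCast]
    push_cast
    field_simp
    ring
  rw [haarFn, h0, h1, h2]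

theorem integrable_indicator_Ico (a b : ℝ) :
    Integrable ((Set.Ico a b).indicator fun _ => (1 : ℂ)) :=
  (integrable_indicator_iff measurableSet_Ico).2 (integrableOn_const (by simp))

theorem integrable_haarFn (j : ℕ) (μ : ℤ) : Integrable (haarFn j μ) := by
  rw [show haarFn j μ = _ from funext (haarFn_eq j μ)]
  exact (integrable_indicator_Ico _ _).sub (integrable_indicator_Ico _ _)

theorem norm_haarFn_le (j : ℕ) (μ : ℤ) (x : ℝ) : ‖haarFn j μ x‖ ≤
    (Set.Icc (latticePt j (2 * μ)) (latticePt j (2 * μ + 2))).indicator (fun _ => (1 : ℝ)) x := by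
  have h : (0 : ℝ) < 1 / 2 ^ (j + 1) := by positivity
  rw [haarFn_eq]
  simp only [latticePt_add, Set.indicator_apply, Set.mem_Ico, Set.mem_Icc]
  push_cast
  split_ifs with h1 h2 h3 h4 h5 <;> simp <;> first | linarith | (exfalso; grind)

theorem integral_haarFn_mul (j : ℕ) (μ : ℤ) {F : ℝ → ℂ} (hF : Continuous F) :
    ∫ t, haarFn j μ t * F t =
      (∫ t in latticePt j (2 * μ)..latticePt j (2 * μ + 1), F t) -
        ∫ t in latticePt j (2 * μ + 1)..latticePt j (2 * μ + 2), F t := by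
  have h : (0 : ℝ) < 1 / 2 ^ (j + 1) := by positivity
  have h01 : latticePt j (2 * μ) ≤ latticePt j (2 * μ + 1) := by
    rw [latticePt_add]
    push_cast
    linarith
  have h12 : latticePt j (2 * μ + 1) ≤ latticePt j (2 * μ + 2) := by
    rw [latticePt_add, latticePt_add]
    push_cast
    linarith
  have hInt : ∀ a b : ℝ, IntegrableOn F (Set.Ico a b) := fun a b =>
    (hF.integrableOn_Icc (a := a) (b := b)).mono_set Set.Ico_subset_Icc_self
  have hind : ∀ a b : ℝ, (fun t => (Set.Ico a b).indicator (fun _ => (1 : ℂ)) t * F t) =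
      (Set.Ico a b).indicator F := fun a b => funext fun t => by
    simp [Set.indicator_apply]
  simp_rw [haarFn_eq, sub_mul]
  rw [integral_sub, hind, hind, integral_indicator measurableSet_Ico,
    integral_indicator measurableSet_Ico, intervalIntegral.integral_of_le h01,
    intervalIntegral.integral_of_le h12, integral_Ico_eq_integral_Ioo,
    integral_Ico_eq_integral_Ioo, integral_Ioc_eq_integral_Ioo, integral_Ioc_eq_integral_Ioo]
  · rw [hind]
    exact (integrable_indicator_iff measurableSet_Ico).2 (hInt _ _)
  · rw [hind]
    exact (integrable_indicator_iff measurableSet_Ico).2 (hInt _ _)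

theorem bump_four_le_of_abs_le {l j : ℕ} (hlj : l ≤ j) {μ : ℤ} {t b : ℝ}
    (ht : t ∈ Set.Icc (latticePt j (2 * μ)) (latticePt j (2 * μ + 2)))
    (hb : b ∈ Set.Icc (latticePt j (2 * μ)) (latticePt j (2 * μ + 2))) (x : ℝ) :
    bump 4 (2 ^ l * (x - t)) ≤ 16 * bump 4 (2 ^ l * (x - b)) := by
  refine (bump_le_mul 4 _ (2 ^ l * (x - b))).trans ?_
  gcongr
  · exact (bump_pos _ _).le
  have h1 : |b - t| ≤ 1 / 2 ^ j := by
    rw [latticePt_add] at ht hb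
    have h2 : ((2 : ℤ) : ℝ) * (1 / 2 ^ (j + 1)) = 1 / 2 ^ j := by
      rw [pow_succ]
      push_cast
      field_simp
    rw [h2] at ht hb
    rw [abs_le]
    constructor <;> linarith [ht.1, ht.2, hb.1, hb.2]
  have h3 : |2 ^ l * (x - t) - 2 ^ l * (x - b)| ≤ 1 := by
    rw [← mul_sub, abs_two_pow_mul, show x - t - (x - b) = b - t by ring]
    calc (2 : ℝ) ^ l * |b - t| ≤ 2 ^ j * (1 / 2 ^ j) := by
          gcongr
          exact one_le_two
      _ = 1 := by field_simp
  calc (1 + |2 ^ l * (x - t) - 2 ^ l * (x - b)|) ^ 4 ≤ (1 + 1) ^ 4 := by gcongr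
    _ = 16 := by norm_num

theorem integrable_dil_bump_two (k : ℕ) (x : ℝ) :
    Integrable (fun t => 2 ^ k * bump 2 (2 ^ k * (x - t))) ∧
      ∫ t, 2 ^ k * bump 2 (2 ^ k * (x - t)) ≤ 16 := by
  have hsymm : ∀ t, bump 2 (2 ^ k * (x - t)) = bump 2 (2 ^ k * (t - x)) := fun t => by
    rw [← bump_neg, show -(2 ^ k * (x - t)) = 2 ^ k * (t - x) by ring]
  simp_rw [hsymm]
  have hle := lintegral_bump_two_le k x
  have hc : Continuous fun t => (2 : ℝ) ^ k * bump 2 (2 ^ k * (t - x)) := by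
    have := continuous_bump 2
    fun_prop
  have hnn : ∀ t, 0 ≤ (2 : ℝ) ^ k * bump 2 (2 ^ k * (t - x)) := fun t =>
    mul_nonneg (by positivity) (bump_pos _ _).le
  have hi : Integrable fun t => (2 : ℝ) ^ k * bump 2 (2 ^ k * (t - x)) := by
    refine ⟨hc.aestronglyMeasurable, ?_⟩
    rw [hasFiniteIntegral_iff_ofReal (Filter.Eventually.of_forall hnn)]
    exact hle.trans_lt (by finiteness)
  refine ⟨hi, ?_⟩
  rw [integral_eq_lintegral_of_nonneg_ae (Filter.Eventually.of_forall hnn) hc.aestronglyMeasurable]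
  exact ENNReal.toReal_le_of_le_ofReal (by norm_num) (hle.trans_eq (by norm_num))

theorem norm_integral_haarFn_mul_dil_le_of_le {Ψ : ℝ → ℂ} {C : ℝ} (hC0 : 0 ≤ C)
    (hC : ∀ z, ‖Ψ z‖ ≤ C * bump 6 z) {j k : ℕ} (hjk : j ≤ k) {μ : ℤ} {b : ℝ}
    (hb : b ∈ Set.Icc (latticePt j (2 * μ)) (latticePt j (2 * μ + 2))) (x : ℝ) :
    ‖∫ t, haarFn j μ t * dil k Ψ (x - t)‖ ≤ C * 256 * bump 4 (2 ^ j * (x - b)) := by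
  obtain ⟨hi, hle⟩ := integrable_dil_bump_two k x
  calc ‖∫ t, haarFn j μ t * dil k Ψ (x - t)‖
      ≤ ∫ t, C * 16 * bump 4 (2 ^ j * (x - b)) * (2 ^ k * bump 2 (2 ^ k * (x - t))) := by
        refine norm_integral_le_of_norm_le (hi.const_mul _) (Filter.Eventually.of_forall fun t => ?_)
        rw [norm_mul, norm_dil]
        have hnn : 0 ≤ C * 16 * bump 4 (2 ^ j * (x - b)) * (2 ^ k * bump 2 (2 ^ k * (x - t))) := by
          have := (bump_pos 4 (2 ^ j * (x - b))).le
          have := (bump_pos 2 (2 ^ k * (x - t))).le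
          positivity
        have hh := norm_haarFn_le j μ t
        by_cases ht : t ∈ Set.Icc (latticePt j (2 * μ)) (latticePt j (2 * μ + 2))
        · rw [Set.indicator_of_mem ht] at hh
          have h4 : bump 4 (2 ^ k * (x - t)) ≤ 16 * bump 4 (2 ^ j * (x - b)) := by
            refine (bump_anti ?_).trans (bump_four_le_of_abs_le le_rfl ht hb x)
            rw [abs_two_pow_mul, abs_two_pow_mul]
            gcongr
            exact one_le_two
          calc ‖haarFn j μ t‖ * (2 ^ k * ‖Ψ (2 ^ k * (x - t))‖)
              ≤ 1 * (2 ^ k * (C * bump 6 (2 ^ k * (x - t)))) := by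
                gcongr
                exact hC _
            _ = C * bump 4 (2 ^ k * (x - t)) * (2 ^ k * bump 2 (2 ^ k * (x - t))) := by
                rw [bump_add 4 2]
                ring
            _ ≤ C * (16 * bump 4 (2 ^ j * (x - b))) * (2 ^ k * bump 2 (2 ^ k * (x - t))) := by
                have := (bump_pos 2 (2 ^ k * (x - t))).le
                gcongr
            _ = _ := by ring
        · rw [Set.indicator_of_notMem ht] at hh
          rw [le_antisymm hh (norm_nonneg _), zero_mul]
          exact hnn
    _ = C * 16 * bump 4 (2 ^ j * (x - b)) * ∫ t, 2 ^ k * bump 2 (2 ^ k * (x - t)) :=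
        integral_const_mul _ _
    _ ≤ C * 16 * bump 4 (2 ^ j * (x - b)) * 16 := by
        have := (bump_pos 4 (2 ^ j * (x - b))).le
        gcongr
    _ = _ := by ring

theorem hasDerivAt_dil_sub {Θ Ψ : ℝ → ℂ} (h : ∀ z, HasDerivAt Θ (Ψ z) z) (k : ℕ) (x t : ℝ) :
    HasDerivAt (fun t => Θ (2 ^ k * (x - t))) (-(dil k Ψ (x - t))) t := by
  have h1 : HasDerivAt (fun t : ℝ => (2 : ℝ) ^ k * (x - t)) (-(2 ^ k)) t := by
    simpa using ((hasDerivAt_id t).const_sub x).const_mul ((2 : ℝ) ^ k)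
  convert! (h (2 ^ k * (x - t))).scomp t h1 using 1
  simp [dil]

theorem norm_integral_haarFn_mul_dil_le_of_ge {Ψ Ψ' : ℝ → ℂ} (hΨ : ∀ z, HasDerivAt Ψ (Ψ' z) z)
    {C : ℝ} (hC : ∀ z, ‖Ψ' z‖ ≤ C * bump 4 z) {j k : ℕ} (hkj : k ≤ j)
    {μ : ℤ} {b : ℝ} (hb : b ∈ Set.Icc (latticePt j (2 * μ)) (latticePt j (2 * μ + 2))) (x : ℝ) :
    ‖∫ t, haarFn j μ t * dil k Ψ (x - t)‖ ≤
      C * 4 * (1 / 4) ^ (j - k) * bump 4 (2 ^ k * (x - b)) := by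
  have hΨc : Continuous Ψ := continuous_iff_continuousAt.2 fun z => (hΨ z).continuousAt
  have hC0 : 0 ≤ C := by
    have h := (norm_nonneg _).trans (hC 0)
    have h' := bump_pos 4 0
    exact nonneg_of_mul_nonneg_left h h'
  set η : ℝ := 1 / 2 ^ (j + 1) with hη
  have hη0 : 0 < η := by positivity
  set F : ℝ → ℂ := fun t => dil k Ψ (x - t) with hF
  have hFc : Continuous F := by
    unfold F dil
    fun_prop
  have hp1 : latticePt j (2 * μ + 1) = latticePt j (2 * μ) + η := by
    rw [latticePt_add]
    push_cast
    ring
  have hp2 : latticePt j (2 * μ + 2) = latticePt j (2 * μ) + η + η := by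
    rw [latticePt_add]
    push_cast
    ring
  set a := latticePt j (2 * μ) with ha
  set M : ℝ := 2 ^ k * (2 ^ k * (C * (16 * bump 4 (2 ^ k * (x - b))))) with hM
  have hFd : ∀ t, HasDerivAt F ((2 : ℂ) ^ k * -(dil k Ψ' (x - t))) t := fun t =>
    (hasDerivAt_dil_sub hΨ k x t).const_mul ((2 : ℂ) ^ k)
  have hFd' : ∀ t ∈ Set.Icc a (a + η + η), ‖(2 : ℂ) ^ k * -(dil k Ψ' (x - t))‖ ≤ M := by
    intro t ht
    rw [norm_mul, norm_neg, norm_dil, norm_pow, Complex.norm_ofNat, hM]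
    gcongr
    refine (hC _).trans ?_
    gcongr
    exact bump_four_le_of_abs_le hkj (μ := μ) (by rwa [hp2]) hb x
  have hdiff : ∀ t ∈ Set.Icc a (a + η), ‖F t - F (t + η)‖ ≤ M * η := by
    intro t ht
    have hs : ∀ s ∈ Set.Icc t (t + η), s ∈ Set.Icc a (a + η + η) := fun s hs =>
      ⟨ht.1.trans hs.1, by linarith [hs.2, ht.2]⟩
    have h := (convex_Icc t (t + η)).norm_image_sub_le_of_norm_hasDerivWithin_le
      (f := F) (C := M) (fun s hs' => (hFd s).hasDerivWithinAt)
      (fun s hs' => hFd' s (hs s hs')) (Set.right_mem_Icc.2 (by linarith))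
      (Set.left_mem_Icc.2 (by linarith))
    rwa [show t - (t + η) = -η by ring, norm_neg, Real.norm_of_nonneg hη0.le] at h
  have hshift : ∫ t in (a + η)..(a + η + η), F t = ∫ t in a..(a + η), F (t + η) := by
    rw [intervalIntegral.integral_comp_add_right]
  have hFη : Continuous fun t => F (t + η) := by fun_prop
  rw [integral_haarFn_mul j μ hFc, ← ha, hp1, hp2, hshift, ← intervalIntegral.integral_sub
    (hFc.intervalIntegrable _ _) (hFη.intervalIntegrable _ _)]
  refine (intervalIntegral.norm_integral_le_of_norm_le_const (C := M * η) fun t ht => ?_).trans ?_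
  · rw [Set.uIoc_of_le (by linarith)] at ht
    exact hdiff t ⟨ht.1.le, ht.2⟩
  · rw [show a + η - a = η by ring, abs_of_pos hη0]
    refine le_of_eq ?_
    have h2 : (2 : ℝ) ^ (j + 1) = 2 * (2 ^ k * 2 ^ (j - k)) := by
      rw [← pow_add, Nat.add_sub_cancel' hkj, pow_succ]
      ring
    have h3 : (1 / 4 : ℝ) ^ (j - k) = (1 / 2 ^ (j - k)) ^ 2 := by
      rw [one_div_pow, one_div_pow, ← pow_mul, mul_comm (j - k) 2, pow_mul]
      norm_num
    rw [h3, hM, hη, h2]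
    field_simp
    ring

theorem norm_integral_haarFn_mul_dil_le_of_hasDerivAt {Θ Ψ : ℝ → ℂ} (hΨ : Continuous Ψ)
    (h : ∀ z, HasDerivAt Θ (Ψ z) z) {C : ℝ} (hC : ∀ z, ‖Θ z‖ ≤ C * bump 4 z) (j k : ℕ) (μ : ℤ)
    (x : ℝ) :
    ‖∫ t, haarFn j μ t * dil k Ψ (x - t)‖ ≤
      2 * C * ∑ i ∈ Finset.range 3, bump 4 (2 ^ k * (x - latticePt j (2 * μ + i))) := by
  have hFc : Continuous fun t => dil k Ψ (x - t) := by
    unfold dil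
    fun_prop
  have hFTC : ∀ a b : ℝ, ∫ t in a..b, dil k Ψ (x - t) =
      Θ (2 ^ k * (x - a)) - Θ (2 ^ k * (x - b)) := fun a b => by
    rw [intervalIntegral.integral_eq_sub_of_hasDerivAt
      (f := fun t => -Θ (2 ^ k * (x - t))) (fun t _ => ?_) (hFc.intervalIntegrable _ _)]
    · ring
    · have hd := (hasDerivAt_dil_sub h k x t).neg
      rw [neg_neg] at hd
      exact hd
  have hC0 : 0 ≤ C := by
    have h := (norm_nonneg _).trans (hC 0)
    exact nonneg_of_mul_nonneg_left h (bump_pos 4 0)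
  rw [integral_haarFn_mul j μ hFc, hFTC, hFTC]
  simp only [Finset.sum_range_succ, Finset.range_zero, Finset.sum_empty, Nat.cast_zero,
    Nat.cast_one, Nat.cast_ofNat, add_zero, zero_add]
  have h0 := hC (2 ^ k * (x - latticePt j (2 * μ)))
  have h1 := hC (2 ^ k * (x - latticePt j (2 * μ + 1)))
  have h2 := hC (2 ^ k * (x - latticePt j (2 * μ + 2)))
  have b0 := (norm_nonneg _).trans h0
  have b1 := (norm_nonneg _).trans h2
  refine (norm_sub_le _ _).trans ((add_le_add (norm_sub_le _ _) (norm_sub_le _ _)).trans ?_)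
  linarith

open scoped SchwartzMap

/-- The symbol `ξ ↦ ψ (a ξ)`. -/
def scaleSymbol (a : ℝˣ) (ψ : 𝓢(ℝ, ℂ)) : 𝓢(ℝ, ℂ) :=
  SchwartzMap.compCLMOfContinuousLinearEquiv ℂ (ContinuousLinearEquiv.unitsEquivAut ℝ a) ψ

theorem scaleSymbol_apply (a : ℝˣ) (ψ : 𝓢(ℝ, ℂ)) (ξ : ℝ) : scaleSymbol a ψ ξ = ψ (ξ * a) := by
  simp [scaleSymbol]

/-- The number `2` as a unit of `ℝ`. -/
def twoUnit : ℝˣ := Units.mk0 2 two_ne_zero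

theorem scaleSymbol_two_zpow_apply (n : ℤ) (ψ : 𝓢(ℝ, ℂ)) (ξ : ℝ) :
    scaleSymbol (twoUnit ^ n) ψ ξ = ψ (ξ * 2 ^ n) := by
  simp [scaleSymbol_apply, twoUnit]

theorem fourierInv_scaleSymbol (m : ℕ) (ψ : 𝓢(ℝ, ℂ)) (z : ℝ) :
    𝓕⁻ (scaleSymbol (twoUnit ^ (-(m : ℤ))) ψ) z = dil m (𝓕⁻ ψ : 𝓢(ℝ, ℂ)) z := by
  rw [SchwartzMap.fourierInv_coe, dil, SchwartzMap.fourierInv_coe, Real.fourierInv_eq',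
    Real.fourierInv_eq']
  have h := Measure.integral_comp_div
    (fun v : ℝ => Complex.exp (↑(2 * π * inner ℝ v ((2 : ℝ) ^ m * z)) * Complex.I) • ψ v) ((2 : ℝ) ^ m)
  rw [abs_of_pos (by positivity), Complex.real_smul, Complex.ofReal_pow,
    Complex.ofReal_ofNat] at h
  rw [← h]
  congr 1
  ext v
  rw [scaleSymbol_two_zpow_apply, zpow_neg, zpow_natCast, div_eq_mul_inv]
  congr 3
  simp
  field_simp

/-- The Fourier multiplier operator with symbol `ψ`. -/
def mulOp (ψ f : 𝓢(ℝ, ℂ)) : 𝓢(ℝ, ℂ) :=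
  SchwartzMap.convolution (ContinuousLinearMap.mul ℂ ℂ) f (𝓕⁻ ψ)

theorem mulOp_apply (ψ f : 𝓢(ℝ, ℂ)) (x : ℝ) :
    mulOp ψ f x = ∫ t, f t * (𝓕⁻ ψ : 𝓢(ℝ, ℂ)) (x - t) := by
  rw [mulOp, SchwartzMap.convolution_apply, convolution_def]
  simp

theorem fourier_mulOp (ψ f : 𝓢(ℝ, ℂ)) (ξ : ℝ) : 𝓕 (mulOp ψ f) ξ = 𝓕 f ξ * ψ ξ := by
  rw [mulOp, SchwartzMap.fourier_convolution, SchwartzMap.pairing_apply_apply]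
  simp

theorem mulOp_eq_integral (ψ f : 𝓢(ℝ, ℂ)) (x : ℝ) :
    mulOp ψ f x = ∫ ξ, Complex.exp (↑(2 * π * (ξ * x)) * Complex.I) * (𝓕 f ξ * ψ ξ) := by
  have h : mulOp ψ f = 𝓕⁻ (𝓕 (mulOp ψ f)) := by simp
  rw [h, SchwartzMap.fourierInv_coe, Real.fourierInv_eq']
  congr 1
  ext ξ
  rw [fourier_mulOp]
  simp [mul_comm x ξ]

theorem eq_integral_fourier (f : 𝓢(ℝ, ℂ)) (x : ℝ) :
    f x = ∫ ξ, Complex.exp (↑(2 * π * (ξ * x)) * Complex.I) * 𝓕 f ξ := by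
  have h : f = 𝓕⁻ (𝓕 f) := by simp
  nth_rw 1 [h]
  rw [SchwartzMap.fourierInv_coe, Real.fourierInv_eq']
  congr 1
  ext ξ
  simp [mul_comm x ξ]

theorem mulOp_mulOp_of_mul_eq {ψ θ : 𝓢(ℝ, ℂ)} (h : ∀ ξ, ψ ξ * θ ξ = ψ ξ) (f : 𝓢(ℝ, ℂ)) :
    mulOp θ (mulOp ψ f) = mulOp ψ f := by
  ext x
  rw [mulOp_eq_integral, mulOp_eq_integral]
  congr 1
  ext ξ
  rw [fourier_mulOp, mul_assoc (𝓕 f ξ), h]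

/-- The normalized symbols of the Littlewood–Paley pieces. -/
def lpSymbol (φ : 𝓢(ℝ, ℂ)) (m : ℕ) : 𝓢(ℝ, ℂ) :=
  if m = 0 then φ else φ - scaleSymbol (twoUnit ^ (1 : ℤ)) φ

/-- Symbols equal to one on the supports of the `lpSymbol`s. -/
def wideSymbol (φ : 𝓢(ℝ, ℂ)) (m : ℕ) : 𝓢(ℝ, ℂ) :=
  if m = 0 then scaleSymbol (twoUnit ^ (-1 : ℤ)) φ else
    scaleSymbol (twoUnit ^ (-1 : ℤ)) φ - scaleSymbol (twoUnit ^ (2 : ℤ)) φ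

/-- The Littlewood–Paley piece of a Schwartz function. -/
def lpPiece (φ : 𝓢(ℝ, ℂ)) (m : ℕ) (f : 𝓢(ℝ, ℂ)) : 𝓢(ℝ, ℂ) :=
  mulOp (scaleSymbol (twoUnit ^ (-(m : ℤ))) (lpSymbol φ m)) f

theorem LPop_eq (φ : 𝓢(ℝ, ℂ)) (m : ℕ) (g : ℝ → ℂ) (x : ℝ) :
    LPop φ m g x = ∫ t, g t * dil m (𝓕⁻ (lpSymbol φ m) : 𝓢(ℝ, ℂ)) (x - t) := by
  rw [LPop]
  split_ifs with hm
  · simp [conv, dil, hm, lpSymbol, SchwartzMap.fourierInv_coe]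
  · have h : (fun ξ => φ ξ - φ (2 * ξ)) = lpSymbol φ m := by
      ext ξ
      rw [lpSymbol, if_neg hm, sub_apply, scaleSymbol_two_zpow_apply]
      simp [mul_comm]
    simp [conv, dil, h, SchwartzMap.fourierInv_coe]

theorem LPop_eq_lpPiece (φ : 𝓢(ℝ, ℂ)) (m : ℕ) (f : 𝓢(ℝ, ℂ)) (x : ℝ) :
    LPop φ m f x = lpPiece φ m f x := by
  rw [LPop_eq, lpPiece, mulOp_apply]
  simp only [fourierInv_scaleSymbol]

theorem sum_range_lpSymbol (φ : 𝓢(ℝ, ℂ)) (M : ℕ) (ξ : ℝ) :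
    ∑ m ∈ Finset.range (M + 1), lpSymbol φ m (ξ * 2 ^ (-(m : ℤ))) = φ (ξ * 2 ^ (-(M : ℤ))) := by
  induction M with
  | zero => simp [lpSymbol]
  | succ M ih =>
    rw [Finset.sum_range_succ, ih, lpSymbol, if_neg (by omega), sub_apply,
      scaleSymbol_two_zpow_apply, mul_assoc, ← zpow_add₀ two_ne_zero,
      show -((M + 1 : ℕ) : ℤ) + 1 = -(M : ℤ) by push_cast; ring]
    ring

theorem exists_norm_le_bump (f : 𝓢(ℝ, ℂ)) (n : ℕ) : ∃ C : ℝ, 0 ≤ C ∧ ∀ z, ‖f z‖ ≤ C * bump n z := by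
  have h : ∃ C : ℝ, ∀ z, ‖f z‖ ≤ C * bump n z := by
    refine ⟨2 ^ n * (Finset.Iic (n, 0)).sup (fun m => SchwartzMap.seminorm ℝ m.1 m.2) f, fun z => ?_⟩
    have h := SchwartzMap.one_add_le_sup_seminorm_apply (𝕜 := ℝ) (m := (n, 0)) le_rfl le_rfl f z
    rw [norm_iteratedFDeriv_zero, Real.norm_eq_abs, mul_comm] at h
    rw [bump, ← div_eq_mul_inv, le_div_iff₀ (by positivity)]
    exact h
  obtain ⟨C, h⟩ := h
  refine ⟨C, ?_, h⟩
  have h0 := (norm_nonneg _).trans (h 0)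
  exact nonneg_of_mul_nonneg_left h0 (bump_pos n 0)

theorem exists_norm_le (f : 𝓢(ℝ, ℂ)) : ∃ C : ℝ, 0 ≤ C ∧ ∀ z, ‖f z‖ ≤ C := by
  obtain ⟨C, hC, h⟩ := exists_norm_le_bump f 0
  exact ⟨C, hC, fun z => by simpa [bump] using h z⟩

theorem integrable_exp_mul_fourier_mul (ψ f : 𝓢(ℝ, ℂ)) (x : ℝ) :
    Integrable fun ξ : ℝ => Complex.exp (↑(2 * π * (ξ * x)) * Complex.I) * (𝓕 f ξ * ψ ξ) := by
  have h := (𝓕 (mulOp ψ f) : 𝓢(ℝ, ℂ)).integrable (μ := volume)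
  simp only [← fourier_mulOp]
  refine h.bdd_mul (c := 1) ?_ ?_
  · exact (by fun_prop : Continuous fun ξ : ℝ =>
      Complex.exp (↑(2 * π * (ξ * x)) * Complex.I)).aestronglyMeasurable
  · exact .of_forall fun ξ => (Complex.norm_exp_ofReal_mul_I _).le

theorem sum_range_lpPiece (φ f : 𝓢(ℝ, ℂ)) (M : ℕ) (x : ℝ) :
    ∑ m ∈ Finset.range (M + 1), lpPiece φ m f x =
      ∫ ξ, Complex.exp (↑(2 * π * (ξ * x)) * Complex.I) * (𝓕 f ξ * φ (ξ * 2 ^ (-(M : ℤ)))) := by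
  simp only [lpPiece, mulOp_eq_integral]
  rw [← integral_finsetSum _ fun m _ => integrable_exp_mul_fourier_mul _ _ _]
  congr 1
  ext ξ
  rw [← sum_range_lpSymbol, Finset.mul_sum, Finset.mul_sum]
  simp only [scaleSymbol_two_zpow_apply]

theorem tendsto_sum_range_lpPiece {φ : 𝓢(ℝ, ℂ)} (hφ : φ 0 = 1) (f : 𝓢(ℝ, ℂ)) (x : ℝ) :
    Filter.Tendsto (fun M => ∑ m ∈ Finset.range (M + 1), lpPiece φ m f x) Filter.atTop
      (nhds (f x)) := by
  obtain ⟨C, hC, hCφ⟩ := exists_norm_le φ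
  simp only [sum_range_lpPiece]
  rw [eq_integral_fourier f x]
  refine tendsto_integral_of_dominated_convergence (fun ξ => ‖𝓕 f ξ‖ * C) (fun M => ?_)
    ((𝓕 f : 𝓢(ℝ, ℂ)).integrable.norm.mul_const C) (fun M => .of_forall fun ξ => ?_)
    (.of_forall fun ξ => ?_)
  · have h1 : Continuous (𝓕 f : 𝓢(ℝ, ℂ)) := SchwartzMap.continuous _
    have h2 : Continuous φ := φ.continuous
    exact Continuous.aestronglyMeasurable (by fun_prop)
  · rw [norm_mul, norm_mul, Complex.norm_exp_ofReal_mul_I, one_mul]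
    gcongr
    exact hCφ _
  · have h1 : Filter.Tendsto (fun M : ℕ => ξ * (2 : ℝ) ^ (-(M : ℤ))) Filter.atTop (nhds 0) := by
      simp only [zpow_neg, zpow_natCast, ← inv_pow]
      simpa using (tendsto_pow_atTop_nhds_zero_of_lt_one (r := (2 : ℝ)⁻¹) (by norm_num)
        (by norm_num)).const_mul ξ
    have h2 := (φ.continuous.tendsto 0).comp h1
    rw [hφ] at h2
    simpa using (h2.const_mul (𝓕 f ξ)).const_mul (Complex.exp (↑(2 * π * (ξ * x)) * Complex.I))

theorem exists_norm_sum_range_lpPiece_le (φ f : 𝓢(ℝ, ℂ)) :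
    ∃ B : ℝ, ∀ M x, ‖∑ m ∈ Finset.range (M + 1), lpPiece φ m f x‖ ≤ B := by
  obtain ⟨C, hC, hCφ⟩ := exists_norm_le φ
  refine ⟨∫ ξ, ‖𝓕 f ξ‖ * C, fun M x => ?_⟩
  rw [sum_range_lpPiece]
  refine norm_integral_le_of_norm_le ((𝓕 f : 𝓢(ℝ, ℂ)).integrable.norm.mul_const C)
    (.of_forall fun ξ => ?_)
  rw [norm_mul, norm_mul, Complex.norm_exp_ofReal_mul_I, one_mul]
  gcongr
  exact hCφ _

theorem integrable_mul_haarFn (f : 𝓢(ℝ, ℂ)) (j : ℕ) (μ : ℤ) :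
    Integrable fun y => f y * haarFn j μ y := by
  obtain ⟨C, -, hC⟩ := exists_norm_le f
  exact (integrable_haarFn j μ).bdd_mul f.continuous.aestronglyMeasurable (.of_forall hC)

theorem enorm_integral_mul_haarFn_le_tsum {φ : 𝓢(ℝ, ℂ)} (hφ : φ 0 = 1) (f : 𝓢(ℝ, ℂ)) (j : ℕ)
    (μ : ℤ) : ‖∫ y, f y * haarFn j μ y‖ₑ ≤ ∑' m, ‖∫ y, lpPiece φ m f y * haarFn j μ y‖ₑ := by
  obtain ⟨B, hB⟩ := exists_norm_sum_range_lpPiece_le φ f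
  have hsum : ∀ M : ℕ, ∫ y, (∑ m ∈ Finset.range (M + 1), lpPiece φ m f y) * haarFn j μ y =
      ∑ m ∈ Finset.range (M + 1), ∫ y, lpPiece φ m f y * haarFn j μ y := fun M => by
    simp only [Finset.sum_mul]
    exact integral_finsetSum _ fun m _ => integrable_mul_haarFn _ _ _
  have h : Filter.Tendsto
      (fun M => ∫ y, (∑ m ∈ Finset.range (M + 1), lpPiece φ m f y) * haarFn j μ y) Filter.atTop
      (nhds (∫ y, f y * haarFn j μ y)) := by
    refine tendsto_integral_of_dominated_convergence (fun y => B * ‖haarFn j μ y‖) (fun M => ?_)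
      ((integrable_haarFn j μ).norm.const_mul B) (fun M => .of_forall fun y => ?_)
      (.of_forall fun y => ?_)
    · simp only [Finset.sum_mul]
      exact (integrable_finsetSum _ fun m _ => integrable_mul_haarFn _ _ _).aestronglyMeasurable
    · rw [norm_mul]
      gcongr
      exact hB M y
    · exact (tendsto_sum_range_lpPiece hφ f y).mul_const _
  refine le_of_tendsto h.enorm (.of_forall fun M => ?_)
  rw [hsum]
  exact (enorm_sum_le _ _).trans (ENNReal.sum_le_tsum _)

theorem integral_mulOp_mul_haarFn (θ g : 𝓢(ℝ, ℂ)) (m j : ℕ) (μ : ℤ) :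
    ∫ y, mulOp (scaleSymbol (twoUnit ^ (-(m : ℤ))) θ) g y * haarFn j μ y =
      ∫ t, g t * ∫ y, haarFn j μ y * dil m (𝓕 θ : 𝓢(ℝ, ℂ)) (t - y) := by
  set K : 𝓢(ℝ, ℂ) := 𝓕⁻ (scaleSymbol (twoUnit ^ (-(m : ℤ))) θ) with hK
  have hdil : ∀ y t, dil m (𝓕 θ : 𝓢(ℝ, ℂ)) (t - y) = K (y - t) := fun y t => by
    rw [hK, fourierInv_scaleSymbol, dil, dil, SchwartzMap.fourierInv_coe,
      Real.fourierInv_eq_fourier_neg, SchwartzMap.fourier_coe, ← mul_neg, neg_sub]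
  simp only [mulOp_apply, hdil]
  obtain ⟨C, -, hC⟩ := exists_norm_le K
  have hInt : Integrable (Function.uncurry fun y t => K (y - t) * (haarFn j μ y * g t))
      (volume.prod volume) := by
    refine ((integrable_haarFn j μ).mul_prod g.integrable).bdd_mul (c := C) ?_
      (.of_forall fun z => hC _)
    have := K.continuous
    exact Continuous.aestronglyMeasurable (by fun_prop)
  calc _ = ∫ y, ∫ t, K (y - t) * (haarFn j μ y * g t) := by
        congr 1
        ext y
        rw [← integral_mul_const]
        congr 1
        ext t
        ring
    _ = ∫ t, ∫ y, K (y - t) * (haarFn j μ y * g t) := integral_integral_swap hInt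
    _ = _ := by
        congr 1
        ext t
        rw [← integral_const_mul]
        congr 1
        ext y
        ring

theorem exists_schwartz_primitive_fourier (ψ : 𝓢(ℝ, ℂ)) {r R : ℝ} (hr : 0 < r)
    (h0 : ∀ ξ, |ξ| ≤ r → ψ ξ = 0) (hR : ∀ ξ, R ≤ |ξ| → ψ ξ = 0) :
    ∃ Θ : 𝓢(ℝ, ℂ), ∀ z, HasDerivAt Θ (𝓕 ψ z) z := by
  set θ : ℝ → ℂ := fun ξ => ψ ξ / (-2 * π * Complex.I * ξ) with hθ
  have hcs : HasCompactSupport θ := by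
    refine HasCompactSupport.intro (isCompact_Icc (a := -R) (b := R)) fun ξ hξ => ?_
    have : R ≤ |ξ| := by
      by_contra! h
      exact hξ ⟨(abs_lt.1 h).1.le, (abs_lt.1 h).2.le⟩
    simp [hθ, hR ξ this]
  have hsm : ContDiff ℝ (⊤ : ℕ∞) θ := by
    rw [contDiff_iff_contDiffAt]
    intro ξ
    by_cases hξ : ξ = 0
    · have : θ =ᶠ[nhds ξ] fun _ => 0 := by
        filter_upwards [Metric.ball_mem_nhds ξ hr] with y hy
        rw [hξ, mem_ball_zero_iff, Real.norm_eq_abs] at hy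
        simp [hθ, h0 y hy.le]
      exact contDiffAt_const.congr_of_eventuallyEq this
    · have h1 : ContDiffAt ℝ (⊤ : ℕ∞) (fun ξ : ℝ => -2 * π * Complex.I * (ξ : ℂ)) ξ :=
        contDiffAt_const.mul Complex.ofRealCLM.contDiff.contDiffAt
      have h2 := (ψ.smooth ⊤).contDiffAt (x := ξ) |>.mul (h1.inv (by simp [hξ, Real.pi_ne_zero]))
      simp only [hθ, div_eq_mul_inv]
      exact h2
  refine ⟨𝓕 (hcs.toSchwartzMap hsm), fun z => ?_⟩
  have hx : Integrable fun x : ℝ => x • θ x :=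
    (continuous_id.smul hsm.continuous).integrable_of_hasCompactSupport (hcs.smul_left (f := id))
  have hi : Integrable θ := hsm.continuous.integrable_of_hasCompactSupport hcs
  have h := Real.hasDerivAt_fourier hi hx z
  have heq : (fun ξ : ℝ => (-2 * π * Complex.I * ξ) • θ ξ) = ψ := by
    ext ξ
    by_cases hξ : ξ = 0
    · simp [hξ, h0 0 (by simpa using hr.le)]
    · have : (ξ : ℂ) ≠ 0 := by exact_mod_cast hξ
      have := Complex.ofReal_ne_zero.2 Real.pi_ne_zero
      simp only [smul_eq_mul, hθ]
      field_simp
  rw [heq] at h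
  exact h

theorem exists_norm_integral_haarFn_mul_dil_le (Ψ : 𝓢(ℝ, ℂ)) : ∃ C : ℝ, 0 ≤ C ∧
    ∀ (k j : ℕ) (μ : ℤ) (x b : ℝ), b ∈ Set.Icc (latticePt j (2 * μ)) (latticePt j (2 * μ + 2)) →
      ‖∫ t, haarFn j μ t * dil k Ψ (x - t)‖ ≤
        C * (1 / 4) ^ (j - k) * bump 4 (2 ^ min k j * (x - b)) := by
  obtain ⟨C₁, h₁0, h₁⟩ := exists_norm_le_bump Ψ 6
  obtain ⟨C₂, h₂0, h₂⟩ := exists_norm_le_bump (SchwartzMap.derivCLM ℝ ℂ Ψ) 4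
  refine ⟨C₁ * 256 + C₂ * 4, by positivity, fun k j μ x b hb => ?_⟩
  have hpos := fun z => (bump_pos 4 z).le
  rcases le_total j k with h | h
  · refine (norm_integral_haarFn_mul_dil_le_of_le h₁0 h₁ h hb x).trans ?_
    rw [Nat.sub_eq_zero_of_le h, min_eq_right h, pow_zero, mul_one]
    exact mul_le_mul_of_nonneg_right (by linarith) (hpos _)
  · have hd : ∀ z, HasDerivAt Ψ (SchwartzMap.derivCLM ℝ ℂ Ψ z) z := fun z => by
      rw [SchwartzMap.derivCLM_apply]
      exact Ψ.differentiableAt.hasDerivAt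
    refine (norm_integral_haarFn_mul_dil_le_of_ge hd h₂ h hb x).trans ?_
    rw [min_eq_left h]
    refine mul_le_mul_of_nonneg_right (mul_le_mul_of_nonneg_right ?_ (by positivity)) (hpos _)
    linarith

theorem latticePt_mem_Icc (j : ℕ) (μ : ℤ) {i : ℕ} (hi : i ∈ Finset.range 3) :
    latticePt j (2 * μ + i) ∈ Set.Icc (latticePt j (2 * μ)) (latticePt j (2 * μ + 2)) := by
  have h : (0 : ℝ) < 1 / 2 ^ (j + 1) := by positivity
  have hi2 : (i : ℝ) ≤ 2 := by
    have := Finset.mem_range.1 hi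
    exact_mod_cast (by omega : i ≤ 2)
  rw [latticePt_add, latticePt_add]
  push_cast
  exact ⟨by nlinarith [i.cast_nonneg (α := ℝ)], by nlinarith⟩

theorem wideSymbol_of_ne_zero (φ : 𝓢(ℝ, ℂ)) {m : ℕ} (hm : m ≠ 0) :
    wideSymbol φ m = wideSymbol φ 1 := by simp [wideSymbol, hm]

theorem wideSymbol_one_apply (φ : 𝓢(ℝ, ℂ)) (ξ : ℝ) :
    wideSymbol φ 1 ξ = φ (ξ * 2⁻¹) - φ (ξ * 4) := by
  rw [wideSymbol, if_neg one_ne_zero, sub_apply, scaleSymbol_two_zpow_apply,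
    scaleSymbol_two_zpow_apply]
  norm_num

theorem lpSymbol_mul_wideSymbol {φ : 𝓢(ℝ, ℂ)}
    (hone : ∀ ξ : ℝ, |ξ| ≤ 4 / 3 → φ ξ = 1) (hzero : ∀ ξ : ℝ, 3 / 2 ≤ |ξ| → φ ξ = 0) (m : ℕ) (ξ : ℝ) :
    lpSymbol φ m ξ * wideSymbol φ m ξ = lpSymbol φ m ξ := by
  have h2 : |ξ * 2⁻¹| = |ξ| * 2⁻¹ := by rw [abs_mul]; norm_num
  have h4 : |ξ * 4| = |ξ| * 4 := by rw [abs_mul]; norm_num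
  have h1 : |ξ * 2| = |ξ| * 2 := by rw [abs_mul]; norm_num
  by_cases hm : m = 0
  · rw [lpSymbol, wideSymbol, if_pos hm, if_pos hm, scaleSymbol_two_zpow_apply, zpow_neg_one]
    rcases le_total (3 / 2) |ξ| with h | h
    · simp [hzero ξ h]
    · rw [hone (ξ * 2⁻¹) (by rw [h2]; linarith), mul_one]
  · rw [wideSymbol_of_ne_zero _ hm, wideSymbol_one_apply, lpSymbol, if_neg hm,
      sub_apply, scaleSymbol_two_zpow_apply, zpow_one]
    rcases le_total (3 / 2) |ξ| with h | h
    · simp [hzero ξ h, hzero (ξ * 2) (by rw [h1]; linarith)]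
    rcases le_total |ξ| (1 / 2) with h' | h'
    · simp [hone ξ (by linarith), hone (ξ * 2) (by rw [h1]; linarith)]
    · rw [hone (ξ * 2⁻¹) (by rw [h2]; linarith), hzero (ξ * 4) (by rw [h4]; linarith)]
      ring

theorem exists_norm_integral_haarFn_mul_wide_le {φ : 𝓢(ℝ, ℂ)}
    (hone : ∀ ξ : ℝ, |ξ| ≤ 4 / 3 → φ ξ = 1) (hzero : ∀ ξ : ℝ, 3 / 2 ≤ |ξ| → φ ξ = 0) : ∃ C : ℝ, 0 ≤ C ∧ ∀ (m j : ℕ) (μ : ℤ) (t : ℝ),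
      ‖∫ y, haarFn j μ y * dil m (𝓕 (wideSymbol φ m) : 𝓢(ℝ, ℂ)) (t - y)‖ ≤
        C * (1 / 4) ^ (j - m) *
          ∑ i ∈ Finset.range 3, bump 4 (2 ^ m * (t - latticePt j (2 * μ + i))) := by
  obtain ⟨C₀, h₀0, h₀⟩ := exists_norm_integral_haarFn_mul_dil_le (𝓕 (wideSymbol φ 0))
  obtain ⟨C₁, h₁0, h₁⟩ := exists_norm_integral_haarFn_mul_dil_le (𝓕 (wideSymbol φ 1))
  obtain ⟨Θ, hΘ⟩ := exists_schwartz_primitive_fourier (wideSymbol φ 1) (r := 1 / 3) (R := 3)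
    (by norm_num)
    (fun ξ hξ => by
      rw [wideSymbol_one_apply, hone, hone, sub_self] <;> rw [abs_mul] <;> norm_num <;> linarith)
    (fun ξ hξ => by
      rw [wideSymbol_one_apply, hzero, hzero, sub_self] <;> rw [abs_mul] <;> norm_num <;> linarith)
  obtain ⟨C₂, h₂0, h₂⟩ := exists_norm_le_bump Θ 4
  refine ⟨C₀ + C₁ + 2 * C₂, by positivity, fun m j μ t => ?_⟩
  have hpos := fun z => (bump_pos 4 z).le
  have hmem := latticePt_mem_Icc j μ (i := 0) (by simp)
  have hsum : bump 4 (2 ^ m * (t - latticePt j (2 * μ + (0 : ℕ)))) ≤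
      ∑ i ∈ Finset.range 3, bump 4 (2 ^ m * (t - latticePt j (2 * μ + i))) :=
    Finset.single_le_sum (f := fun i : ℕ => bump 4 (2 ^ m * (t - latticePt j (2 * μ + i))))
      (fun i _ => hpos _) (by simp)
  rcases le_or_gt m j with h | h
  · have key : ‖∫ y, haarFn j μ y * dil m (𝓕 (wideSymbol φ m) : 𝓢(ℝ, ℂ)) (t - y)‖ ≤
        (C₀ + C₁ + 2 * C₂) * (1 / 4) ^ (j - m) *
          bump 4 (2 ^ m * (t - latticePt j (2 * μ + (0 : ℕ)))) := by
      by_cases hm : m = 0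
      · subst hm
        refine (h₀ 0 j μ t _ hmem).trans ?_
        rw [min_eq_left h]
        exact mul_le_mul_of_nonneg_right (mul_le_mul_of_nonneg_right (by linarith)
          (by positivity)) (hpos _)
      · rw [wideSymbol_of_ne_zero φ hm]
        refine (h₁ m j μ t _ hmem).trans ?_
        rw [min_eq_left h]
        exact mul_le_mul_of_nonneg_right (mul_le_mul_of_nonneg_right (by linarith)
          (by positivity)) (hpos _)
    exact key.trans (mul_le_mul_of_nonneg_left hsum (by positivity))
  · rw [wideSymbol_of_ne_zero φ (by omega), Nat.sub_eq_zero_of_le h.le, pow_zero, mul_one]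
    refine (norm_integral_haarFn_mul_dil_le_of_hasDerivAt (SchwartzMap.continuous _) hΘ h₂
      j m μ t).trans ?_
    exact mul_le_mul_of_nonneg_right (by linarith) (Finset.sum_nonneg fun i _ => hpos _)

theorem exists_enorm_integral_mul_haarFn_le {φ : 𝓢(ℝ, ℂ)}
    (hone : ∀ ξ : ℝ, |ξ| ≤ 4 / 3 → φ ξ = 1) (hzero : ∀ ξ : ℝ, 3 / 2 ≤ |ξ| → φ ξ = 0) : ∃ C : ℝ, 0 ≤ C ∧
      ∀ (f : 𝓢(ℝ, ℂ)) (j : ℕ) (μ : ℤ), ‖∫ y, f y * haarFn j μ y‖ₑ ≤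
        ∑' m : ℕ, ENNReal.ofReal (C * (1 / 4) ^ (j - m)) * ∑ i ∈ Finset.range 3,
          ∫⁻ y, ENNReal.ofReal (bump 4 (2 ^ m * (y - latticePt j (2 * μ + i)))) *
            ‖lpPiece φ m f y‖ₑ := by
  obtain ⟨C, hC0, hC⟩ := exists_norm_integral_haarFn_mul_wide_le hone hzero
  refine ⟨C, hC0, fun f j μ => ?_⟩
  refine (enorm_integral_mul_haarFn_le_tsum (hone 0 (by norm_num)) f j μ).trans ?_
  refine ENNReal.tsum_le_tsum fun m => ?_
  set g := lpPiece φ m f with hg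
  have hrep : mulOp (scaleSymbol (twoUnit ^ (-(m : ℤ))) (wideSymbol φ m)) g = g := by
    rw [hg, lpPiece]
    refine mulOp_mulOp_of_mul_eq (fun ξ => ?_) f
    rw [scaleSymbol_two_zpow_apply, scaleSymbol_two_zpow_apply,
      lpSymbol_mul_wideSymbol hone hzero]
  have h1 : ∀ b : ℝ, Measurable fun y : ℝ => ENNReal.ofReal (bump 4 (2 ^ m * (y - b))) := fun b =>
    ((continuous_bump 4).comp (by fun_prop)).measurable.ennreal_ofReal
  have h2 : Measurable fun y => ‖g y‖ₑ := g.continuous.measurable.enorm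
  have h3 : ∀ b : ℝ, Measurable fun y : ℝ =>
      ENNReal.ofReal (bump 4 (2 ^ m * (y - b))) * ‖g y‖ₑ := fun b => (h1 b).mul h2
  rw [← hrep, integral_mulOp_mul_haarFn, hrep]
  refine (enorm_integral_le_lintegral_enorm _).trans ?_
  rw [← lintegral_finsetSum _ fun i _ => h3 _,
    ← lintegral_const_mul _ (Finset.measurable_fun_sum _ fun i _ => h3 _)]
  refine lintegral_mono fun t => ?_
  rw [enorm_mul, ← Finset.sum_mul, ← mul_assoc, mul_comm]
  refine mul_le_mul_left ?_ _
  rw [← ENNReal.ofReal_sum_of_nonneg fun i _ => (bump_pos _ _).le,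
    ← ENNReal.ofReal_mul (by positivity), ← ofReal_norm]
  exact ENNReal.ofReal_le_ofReal (hC m j μ t)

theorem exists_norm_integral_haarFn_mul_lpSymbol_le (φ : 𝓢(ℝ, ℂ)) : ∃ C : ℝ, 0 ≤ C ∧
    ∀ (k j : ℕ) (μ : ℤ) (x : ℝ), ∀ i ∈ Finset.range 3,
      ‖∫ t, haarFn j μ t * dil k (𝓕⁻ (lpSymbol φ k) : 𝓢(ℝ, ℂ)) (x - t)‖ ≤
        C * (1 / 4) ^ (j - k) * bump 4 (2 ^ min k j * (x - latticePt j (2 * μ + i))) := by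
  obtain ⟨C₀, h₀0, h₀⟩ := exists_norm_integral_haarFn_mul_dil_le (𝓕⁻ (lpSymbol φ 0))
  obtain ⟨C₁, h₁0, h₁⟩ := exists_norm_integral_haarFn_mul_dil_le (𝓕⁻ (lpSymbol φ 1))
  refine ⟨C₀ + C₁, by positivity, fun k j μ x i hi => ?_⟩
  have hmem := latticePt_mem_Icc j μ hi
  have hpos := fun z => (bump_pos 4 z).le
  by_cases hk : k = 0
  · subst hk
    refine (h₀ 0 j μ x _ hmem).trans ?_
    exact mul_le_mul_of_nonneg_right (mul_le_mul_of_nonneg_right (by linarith)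
      (by positivity)) (hpos _)
  · rw [show lpSymbol φ k = lpSymbol φ 1 by simp [lpSymbol, hk]]
    refine (h₁ k j μ x _ hmem).trans ?_
    exact mul_le_mul_of_nonneg_right (mul_le_mul_of_nonneg_right (by linarith)
      (by positivity)) (hpos _)

theorem LPop_haarProj (φ : 𝓢(ℝ, ℂ)) (k : ℕ) (E : Finset (ℕ × ℤ)) (f : ℝ → ℂ) (x : ℝ) :
    LPop φ k (haarProj E f) x = ∑ e ∈ E, (2 : ℂ) ^ e.1 * (∫ y, f y * haarFn e.1 e.2 y) *
      ∫ t, haarFn e.1 e.2 t * dil k (𝓕⁻ (lpSymbol φ k) : 𝓢(ℝ, ℂ)) (x - t) := by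
  obtain ⟨C, -, hC⟩ := exists_norm_le (𝓕⁻ (lpSymbol φ k))
  have hInt : ∀ (j : ℕ) (μ : ℤ),
      Integrable fun t => haarFn j μ t * dil k (𝓕⁻ (lpSymbol φ k) : 𝓢(ℝ, ℂ)) (x - t) := by
    intro j μ
    refine (integrable_haarFn j μ).mul_bdd (c := 2 ^ k * C) ?_ (.of_forall fun t => ?_)
    · have := (𝓕⁻ (lpSymbol φ k) : 𝓢(ℝ, ℂ)).continuous
      unfold dil
      exact Continuous.aestronglyMeasurable (by fun_prop)
    · rw [norm_dil]
      gcongr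
      exact hC _
  rw [LPop_eq]
  simp only [haarProj, Finset.sum_mul]
  rw [integral_finsetSum]
  · refine Finset.sum_congr rfl fun e _ => ?_
    simp only [mul_assoc]
    rw [integral_const_mul, integral_const_mul]
  · intro e _
    simp only [mul_assoc]
    exact ((hInt e.1 e.2).const_mul _).const_mul _

theorem scale_exponent_le {u δ : ℝ} (hδ0 : 0 ≤ δ) (hδ₁ : δ ≤ u) (hδ₂ : δ ≤ 1 - u) (k j m : ℕ) :
    (k : ℝ) * (-1 + u) + j - 2 * ((j - m : ℕ) : ℝ) - 2 * ((j - k : ℕ) : ℝ) ≤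
      -(δ * |(k : ℝ) - j|) - ((j - m : ℕ) : ℝ) - ((m - j : ℕ) : ℝ) * u - j + ((min k j : ℕ) : ℝ) +
        m + m * (-1 + u) := by
  have hk : (k : ℝ) * (-1 + u) - 2 * ((j - k : ℕ) : ℝ) ≤
      -(δ * |(k : ℝ) - j|) + ((min k j : ℕ) : ℝ) + j * (-1 + u) - j := by
    rcases le_total j k with h | h
    · obtain ⟨d, rfl⟩ := Nat.exists_eq_add_of_le h
      have := mul_le_mul_of_nonneg_right hδ₂ d.cast_nonneg (α := ℝ)
      rw [min_eq_right h, Nat.sub_eq_zero_of_le h]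
      push_cast
      rw [add_sub_cancel_left, abs_of_nonneg d.cast_nonneg]
      linarith
    · obtain ⟨d, rfl⟩ := Nat.exists_eq_add_of_le h
      have := mul_le_mul_of_nonneg_right hδ₁ d.cast_nonneg (α := ℝ)
      rw [min_eq_left h, Nat.add_sub_cancel_left]
      push_cast
      rw [sub_add_cancel_left, abs_neg, abs_of_nonneg d.cast_nonneg]
      linarith
  have hm : (j : ℝ) * (-1 + u) + j - ((j - m : ℕ) : ℝ) ≤
      -(((m - j : ℕ) : ℝ) * u) + m + m * (-1 + u) := by
    rcases le_total j m with h | h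
    · obtain ⟨d, rfl⟩ := Nat.exists_eq_add_of_le h
      rw [Nat.add_sub_cancel_left, Nat.sub_eq_zero_of_le h]
      push_cast
      linarith
    · obtain ⟨d, rfl⟩ := Nat.exists_eq_add_of_le h
      have := mul_nonneg (by linarith : 0 ≤ 1 - u) d.cast_nonneg (α := ℝ)
      rw [Nat.add_sub_cancel_left, Nat.sub_eq_zero_of_le h]
      push_cast
      linarith
  linarith

theorem scale_factor_le {q δ : ℝ} (hδ0 : 0 ≤ δ) (hδ₁ : δ ≤ 1 / q) (hδ₂ : δ ≤ 1 - 1 / q)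
    (k j m : ℕ) :
    ENNReal.ofReal (2 ^ ((k : ℝ) * (-1 + 1 / q))) * (ENNReal.ofReal (2 ^ j) *
        (ENNReal.ofReal ((1 / 4) ^ (j - m)) * ENNReal.ofReal ((1 / 4) ^ (j - k)))) ≤
      decay δ k j * (ENNReal.ofReal (2 ^ (-((j - m : ℕ) : ℝ))) *
        (ENNReal.ofReal (2 ^ (-(((m - j : ℕ) : ℝ) / q))) * (ENNReal.ofReal (1 / 2 ^ j) *
          (ENNReal.ofReal (2 ^ min k j) * (ENNReal.ofReal (2 ^ m) *
            ENNReal.ofReal (2 ^ ((m : ℝ) * (-1 + 1 / q)))))))) := by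
  have h4 : ∀ n : ℕ, ((1 : ℝ) / 4) ^ n = 2 ^ (-(2 * (n : ℝ))) := fun n => by
    rw [Real.rpow_neg zero_le_two, Real.rpow_mul zero_le_two, Real.rpow_natCast, one_div, inv_pow]
    norm_num
  have h2 : ∀ n : ℕ, (2 : ℝ) ^ n = 2 ^ (n : ℝ) := fun n => (Real.rpow_natCast 2 n).symm
  have h1 : ∀ n : ℕ, (1 : ℝ) / 2 ^ n = 2 ^ (-(n : ℝ)) := fun n => by
    rw [Real.rpow_neg zero_le_two, Real.rpow_natCast, one_div]
  have hm : ∀ a b : ℝ, ENNReal.ofReal ((2 : ℝ) ^ a) * ENNReal.ofReal (2 ^ b) =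
      ENNReal.ofReal (2 ^ (a + b)) := fun a b => by
    rw [← ENNReal.ofReal_mul (by positivity), Real.rpow_add two_pos]
  simp only [h4, h1, decay]
  simp only [h2, hm]
  refine ENNReal.ofReal_le_ofReal (Real.rpow_le_rpow_of_exponent_le one_le_two ?_)
  have := scale_exponent_le hδ0 hδ₁ hδ₂ k j m
  rw [div_eq_mul_one_div ((m - j : ℕ) : ℝ)]
  linarith

/-- The weighted norms of the Littlewood–Paley pieces. -/
def lpWeight (φ : 𝓢(ℝ, ℂ)) (s : ℝ) (f : 𝓢(ℝ, ℂ)) (m : ℕ) (y : ℝ) : ℝ≥0∞ :=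
  ENNReal.ofReal (2 ^ ((m : ℝ) * s)) * ‖lpPiece φ m f y‖ₑ

theorem measurable_lpWeight (φ : 𝓢(ℝ, ℂ)) (s : ℝ) (f : 𝓢(ℝ, ℂ)) (m : ℕ) :
    Measurable (lpWeight φ s f m) :=
  (lpPiece φ m f).continuous.measurable.enorm.const_mul _

theorem haar_term_le {q δ : ℝ} (hδ0 : 0 ≤ δ) (hδ₁ : δ ≤ 1 / q) (hδ₂ : δ ≤ 1 - 1 / q)
    {C₁ C₂ : ℝ} (hC₁ : 0 ≤ C₁) (hC₂ : 0 ≤ C₂) (φ f : 𝓢(ℝ, ℂ)) (k j m : ℕ) (x b : ℝ) :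
    ENNReal.ofReal (2 ^ ((k : ℝ) * (-1 + 1 / q))) * (ENNReal.ofReal (2 ^ j) *
      (ENNReal.ofReal (C₁ * (1 / 4) ^ (j - m)) *
        (∫⁻ y, ENNReal.ofReal (bump 4 (2 ^ m * (y - b))) * ‖lpPiece φ m f y‖ₑ) *
        ENNReal.ofReal (C₂ * (1 / 4) ^ (j - k) * bump 4 (2 ^ min k j * (x - b))))) ≤
    ENNReal.ofReal (C₁ * C₂) * (decay δ k j * (ENNReal.ofReal (2 ^ (-((j - m : ℕ) : ℝ))) *
      (ENNReal.ofReal (2 ^ (-(((m - j : ℕ) : ℝ) / q))) *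
        (ENNReal.ofReal (1 / 2 ^ j) * dilBump (min k j) (x - b) *
          ∫⁻ y, dilBump m (y - b) * lpWeight φ (-1 + 1 / q) f m y)))) := by
  have hInt : ∫⁻ y, dilBump m (y - b) * lpWeight φ (-1 + 1 / q) f m y =
      ENNReal.ofReal (2 ^ m) * ENNReal.ofReal (2 ^ ((m : ℝ) * (-1 + 1 / q))) *
        ∫⁻ y, ENNReal.ofReal (bump 4 (2 ^ m * (y - b))) * ‖lpPiece φ m f y‖ₑ := by
    rw [← lintegral_const_mul' _ _ (by finiteness)]
    congr 1
    ext y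
    rw [dilBump, lpWeight, ENNReal.ofReal_mul (by positivity)]
    ring
  rw [hInt, dilBump, ENNReal.ofReal_mul (p := (2 : ℝ) ^ min k j) (by positivity),
    ENNReal.ofReal_mul hC₁, ENNReal.ofReal_mul (p := C₂ * (1 / 4) ^ (j - k)) (by positivity),
    ENNReal.ofReal_mul hC₁, ENNReal.ofReal_mul hC₂]
  set J := ∫⁻ y, ENNReal.ofReal (bump 4 (2 ^ m * (y - b))) * ‖lpPiece φ m f y‖ₑ
  set β := ENNReal.ofReal (bump 4 (2 ^ min k j * (x - b)))
  calc _ = ENNReal.ofReal (2 ^ ((k : ℝ) * (-1 + 1 / q))) * (ENNReal.ofReal (2 ^ j) *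
        (ENNReal.ofReal ((1 / 4) ^ (j - m)) * ENNReal.ofReal ((1 / 4) ^ (j - k)))) *
        (ENNReal.ofReal C₁ * ENNReal.ofReal C₂ * β * J) := by ring
    _ ≤ _ := mul_le_mul_left (scale_factor_le hδ0 hδ₁ hδ₂ k j m) _
    _ = _ := by ring

theorem tsum_sum_range_three_le (T : ℤ → ℝ≥0∞) :
    ∑' μ : ℤ, ∑ i ∈ Finset.range 3, T (2 * μ + i) ≤ 3 * ∑' ν, T ν := by
  rw [Summable.tsum_finsetSum fun i _ => ENNReal.summable]
  calc _ ≤ ∑ i ∈ Finset.range 3, ∑' ν, T ν := Finset.sum_le_sum fun i _ =>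
        ENNReal.tsum_comp_le_tsum_of_injective (f := fun μ : ℤ => 2 * μ + (i : ℤ))
          (fun a b h => by simpa using h) T
    _ = _ := by simp

theorem sum_le_sum_HFset_tsum (E : Finset (ℕ × ℤ)) (F : ℕ → ℤ → ℝ≥0∞) :
    ∑ e ∈ E, F e.1 e.2 ≤ ∑ j ∈ HFset E, ∑' μ, F j μ := by
  calc _ ≤ ∑ e ∈ HFset E ×ˢ E.image Prod.snd, F e.1 e.2 :=
        Finset.sum_le_sum_of_subset Finset.subset_product
    _ = ∑ j ∈ HFset E, ∑ μ ∈ E.image Prod.snd, F j μ := Finset.sum_product _ _ _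
    _ ≤ _ := Finset.sum_le_sum fun j _ => ENNReal.sum_le_tsum _

theorem exists_enorm_LPop_haarProj_le {φ : 𝓢(ℝ, ℂ)}
    (hone : ∀ ξ : ℝ, |ξ| ≤ 4 / 3 → φ ξ = 1) (hzero : ∀ ξ : ℝ, 3 / 2 ≤ |ξ| → φ ξ = 0)
    {q δ : ℝ} (hδ0 : 0 ≤ δ) (hδ₁ : δ ≤ 1 / q) (hδ₂ : δ ≤ 1 - 1 / q) :
    ∃ K : ℝ≥0∞, K ≠ ∞ ∧ ∀ (E : Finset (ℕ × ℤ)) (f : 𝓢(ℝ, ℂ)) (k : ℕ) (x : ℝ),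
      ENNReal.ofReal (2 ^ ((k : ℝ) * (-1 + 1 / q))) * ‖LPop φ k (haarProj E f) x‖ₑ ≤
        K * haarModel (HFset E) δ q (lpWeight φ (-1 + 1 / q) f) k x := by
  obtain ⟨C₁, hC₁, h₁⟩ := exists_enorm_integral_mul_haarFn_le hone hzero
  obtain ⟨C₂, hC₂, h₂⟩ := exists_norm_integral_haarFn_mul_lpSymbol_le φ
  refine ⟨ENNReal.ofReal (C₁ * C₂) * 3, by finiteness, fun E f k x => ?_⟩
  set A : ℝ≥0∞ := ENNReal.ofReal (2 ^ ((k : ℝ) * (-1 + 1 / q)))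
  set W : ℕ → ℕ → ℝ≥0∞ → ℝ≥0∞ := fun j m T => decay δ k j *
    (ENNReal.ofReal (2 ^ (-((j - m : ℕ) : ℝ))) *
      (ENNReal.ofReal (2 ^ (-(((m - j : ℕ) : ℝ) / q))) * T)) with hW
  set T : ℕ → ℕ → ℤ → ℝ≥0∞ := fun j m ν => ENNReal.ofReal (1 / 2 ^ j) *
    dilBump (min k j) (x - latticePt j ν) *
      ∫⁻ y, dilBump m (y - latticePt j ν) * lpWeight φ (-1 + 1 / q) f m y with hT
  have hterm : ∀ (j : ℕ) (μ : ℤ), A * ‖(2 : ℂ) ^ j * (∫ y, f y * haarFn j μ y) *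
      ∫ t, haarFn j μ t * dil k (𝓕⁻ (lpSymbol φ k) : 𝓢(ℝ, ℂ)) (x - t)‖ₑ ≤
      ENNReal.ofReal (C₁ * C₂) * ∑' m, W j m (∑ i ∈ Finset.range 3, T j m (2 * μ + i)) := by
    intro j μ
    have h2j : ‖(2 : ℂ) ^ j‖ₑ = ENNReal.ofReal (2 ^ j) := by
      rw [← ofReal_norm]
      simp
    set D := ‖∫ t, haarFn j μ t * dil k (𝓕⁻ (lpSymbol φ k) : 𝓢(ℝ, ℂ)) (x - t)‖ₑ with hD
    rw [enorm_mul, enorm_mul, ← hD, h2j]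
    calc _ ≤ A * (ENNReal.ofReal (2 ^ j) * (∑' m : ℕ, ENNReal.ofReal (C₁ * (1 / 4) ^ (j - m)) *
          ∑ i ∈ Finset.range 3, ∫⁻ y, ENNReal.ofReal
            (bump 4 (2 ^ m * (y - latticePt j (2 * μ + i)))) * ‖lpPiece φ m f y‖ₑ) * D) := by
          gcongr
          exact h₁ f j μ
      _ = ∑' m : ℕ, ∑ i ∈ Finset.range 3, A * (ENNReal.ofReal (2 ^ j) *
          (ENNReal.ofReal (C₁ * (1 / 4) ^ (j - m)) * (∫⁻ y, ENNReal.ofReal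
            (bump 4 (2 ^ m * (y - latticePt j (2 * μ + i)))) * ‖lpPiece φ m f y‖ₑ) * D)) := by
          rw [mul_assoc, ← ENNReal.tsum_mul_right, ← ENNReal.tsum_mul_left,
            ← ENNReal.tsum_mul_left]
          refine tsum_congr fun m => ?_
          simp only [Finset.mul_sum, Finset.sum_mul]
      _ ≤ ∑' m : ℕ, ∑ i ∈ Finset.range 3,
          ENNReal.ofReal (C₁ * C₂) * W j m (T j m (2 * μ + i)) := by
          refine ENNReal.tsum_le_tsum fun m => Finset.sum_le_sum fun i hi => ?_
          refine le_trans ?_ (haar_term_le hδ0 hδ₁ hδ₂ hC₁ hC₂ φ f k j m x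
            (latticePt j (2 * μ + i)))
          have hDi : D ≤ ENNReal.ofReal (C₂ * (1 / 4) ^ (j - k) *
              bump 4 (2 ^ min k j * (x - latticePt j (2 * μ + i)))) := by
            rw [hD, ← ofReal_norm]
            exact ENNReal.ofReal_le_ofReal (h₂ k j μ x i hi)
          gcongr
      _ = _ := by
          rw [← ENNReal.tsum_mul_left]
          refine tsum_congr fun m => ?_
          simp only [hW, Finset.mul_sum]
  rw [LPop_haarProj]
  calc _ ≤ ∑ e ∈ E, A * ‖(2 : ℂ) ^ e.1 * (∫ y, f y * haarFn e.1 e.2 y) *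
        ∫ t, haarFn e.1 e.2 t * dil k (𝓕⁻ (lpSymbol φ k) : 𝓢(ℝ, ℂ)) (x - t)‖ₑ := by
        rw [← Finset.mul_sum]
        gcongr
        exact enorm_sum_le _ _
    _ ≤ ∑ e ∈ E, ENNReal.ofReal (C₁ * C₂) *
        ∑' m, W e.1 m (∑ i ∈ Finset.range 3, T e.1 m (2 * e.2 + i)) :=
        Finset.sum_le_sum fun e _ => hterm e.1 e.2
    _ ≤ ∑ j ∈ HFset E, ∑' μ : ℤ, ENNReal.ofReal (C₁ * C₂) *
        ∑' m, W j m (∑ i ∈ Finset.range 3, T j m (2 * μ + i)) :=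
        sum_le_sum_HFset_tsum E fun j μ => ENNReal.ofReal (C₁ * C₂) *
          ∑' m, W j m (∑ i ∈ Finset.range 3, T j m (2 * μ + i))
    _ ≤ ∑ j ∈ HFset E, ENNReal.ofReal (C₁ * C₂) * ∑' m, W j m (3 * ∑' ν, T j m ν) := by
        refine Finset.sum_le_sum fun j _ => ?_
        rw [ENNReal.tsum_mul_left, ENNReal.tsum_comm]
        gcongr with m
        simp only [hW, ENNReal.tsum_mul_left]
        gcongr
        exact tsum_sum_range_three_le (T j m)
    _ = _ := by
        rw [haarModel, ENNReal.tsum_prod', tsum_fintype, ← Finset.sum_coe_sort, mul_assoc,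
          Finset.mul_sum, Finset.mul_sum]
        refine Finset.sum_congr rfl fun j _ => ?_
        congr 1
        rw [← ENNReal.tsum_mul_left]
        refine tsum_congr fun m => ?_
        simp only [hW, hT, latticeOp]
        ring

theorem FNorm_eq (φ₀ : ℝ → ℂ) {p q : ℝ} (hq : 0 < q) (s : ℝ) (g : ℝ → ℂ) :
    FNorm φ₀ p q s g = (∫⁻ x : ℝ, (∑' k : ℕ,
      (ENNReal.ofReal (2 ^ ((k : ℝ) * s)) * ‖LPop φ₀ k g x‖ₑ) ^ q) ^ (p / q)) ^ (1 / p) := by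
  rw [FNorm]
  congr 2
  ext x
  congr 2
  ext k
  rw [ENNReal.mul_rpow_of_nonneg _ _ hq.le, ofReal_norm, ENNReal.ofReal_rpow_of_pos (by positivity),
    ← Real.rpow_mul zero_le_two]

theorem FNorm_schwartz_eq (φ f : 𝓢(ℝ, ℂ)) {p q : ℝ} (hq : 0 < q) (s : ℝ) :
    FNorm φ p q s f =
      (∫⁻ x : ℝ, (∑' k : ℕ, lpWeight φ s f k x ^ q) ^ (p / q)) ^ (1 / p) := by
  rw [FNorm_eq _ hq]
  simp only [LPop_eq_lpPiece, lpWeight]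

theorem card_window_le_ZN (E : Finset (ℕ × ℤ)) (N : ℕ) (k : ℤ) :
    ((HFset E).filter fun j : ℕ => |(j : ℤ) - k| ≤ N).card ≤ ZN E N := by
  refine le_csSup ⟨(HFset E).card, ?_⟩ ⟨k, rfl⟩
  rintro c ⟨l, rfl⟩
  exact Finset.card_filter_le _ _

theorem one_le_ZN {E : Finset (ℕ × ℤ)} (hE : E.Nonempty) (N : ℕ) : 1 ≤ ZN E N := by
  obtain ⟨e, he⟩ := hE
  refine le_trans ?_ (card_window_le_ZN E N e.1)
  exact Finset.card_pos.2 ⟨e.1, by simp [HFset, Finset.mem_image_of_mem Prod.fst he]⟩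

theorem FNorm_zero (φ₀ : ℝ → ℂ) {p q : ℝ} (hp : 0 < p) (hq : 0 < q) (s : ℝ) :
    FNorm φ₀ p q s (fun _ => 0) = 0 := by
  have h : ∀ k x, LPop φ₀ k (fun _ => 0) x = 0 := fun k x => by
    rw [LPop]
    split_ifs <;> simp [conv]
  simp [FNorm_eq _ hq, h, hq, hp]

theorem FNorm_le_of_le_haarModel {p q : ℝ} (hp : 0 < p) (hq : 1 < q) {φ₀ g : ℝ → ℂ} {s δ : ℝ}
    {H : Finset ℕ} {G : ℕ → ℝ → ℝ≥0∞} {K B : ℝ≥0∞} (hK : K ≠ ∞)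
    (h : ∀ (k : ℕ) (x : ℝ), ENNReal.ofReal (2 ^ ((k : ℝ) * s)) * ‖LPop φ₀ k g x‖ₑ ≤
      K * haarModel H δ q G k x)
    (hB : ∫⁻ x, (∑' k, haarModel H δ q G k x ^ q) ^ (p / q) ≤ B) :
    FNorm φ₀ p q s g ≤ K * B ^ (1 / p) := by
  have hq0 : 0 < q := by linarith
  have hpq : 0 ≤ p / q := by positivity
  rw [FNorm_eq _ hq0]
  calc _ ≤ (∫⁻ x, K ^ p * (∑' k, haarModel H δ q G k x ^ q) ^ (p / q)) ^ (1 / p) := by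
        gcongr with x
        calc _ ≤ (∑' k, K ^ q * haarModel H δ q G k x ^ q) ^ (p / q) := by
              gcongr with k
              rw [← ENNReal.mul_rpow_of_nonneg _ _ hq0.le]
              exact ENNReal.rpow_le_rpow (h k x) hq0.le
          _ = _ := by
              rw [ENNReal.tsum_mul_left, ENNReal.mul_rpow_of_nonneg _ _ hpq, ← ENNReal.rpow_mul,
                mul_div_cancel₀ _ hq0.ne']
    _ ≤ (K ^ p * B) ^ (1 / p) := by
        rw [lintegral_const_mul' _ _ (ENNReal.rpow_ne_top_of_nonneg hp.le hK)]
        gcongr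
    _ = _ := by
        rw [ENNReal.mul_rpow_of_nonneg _ _ (by positivity), ← ENNReal.rpow_mul,
          mul_one_div_cancel hp.ne', ENNReal.rpow_one]

/-- Endpoint upper bound: for $1<q<p<\infty$,
$\|P_E f\|_{F^{-1+1/q}_{p,q}}\le C N^{1-1/q} Z_N(E)^{1/q}\|f\|$ whenever
$\#\mathrm{HF}(E)\le 2^N$ and $N\ge N_0$. -/
theorem haar_projection_endpoint_upper_bound
    (p q : ℝ) (hq : 1 < q) (hqp : q < p)
    (φ₀ : ℝ → ℂ) (hφsmooth : ContDiff ℝ (⊤ : ℕ∞) φ₀) (hφcpt : HasCompactSupport φ₀)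
    (hφone : ∀ ξ : ℝ, |ξ| ≤ 4/3 → φ₀ ξ = 1)
    (hφzero : ∀ ξ : ℝ, 3/2 ≤ |ξ| → φ₀ ξ = 0) :
    ∃ C : ℝ, 0 < C ∧ ∃ N₀ : ℕ, ∀ (N : ℕ), N₀ ≤ N → ∀ (E : Finset (ℕ × ℤ)),
      (HFset E).card ≤ 2^N → ∀ f : SchwartzMap ℝ ℂ,
      FNorm φ₀ p q (-1 + 1/q) (haarProj E f) ≤
        ENNReal.ofReal (C * (N:ℝ)^(1 - 1/q) * (ZN E N : ℝ)^(1/q)) *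
          FNorm φ₀ p q (-1 + 1/q) f := by
  have hq0 : 0 < q := by linarith
  have hp0 : 0 < p := by linarith
  have hu : 1 / q < 1 := by rw [div_lt_one hq0]; exact hq
  have hδ : 0 < min (1 / q) (1 - 1 / q) := lt_min (by positivity) (by linarith)
  set φ : 𝓢(ℝ, ℂ) := hφcpt.toSchwartzMap hφsmooth
  have hφ : (φ : ℝ → ℂ) = φ₀ := rfl
  obtain ⟨K, hK, hpt⟩ := exists_enorm_LPop_haarProj_le (φ := φ) hφone hφzero hδ.le
    (min_le_left _ _) (min_le_right _ _)
  obtain ⟨A, hA, hmodel⟩ := exists_lintegral_haarModel_rpow_le hδ hq hqp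
  have hfin : K * A ^ (1 / p) ≠ ∞ := by
    have := ENNReal.rpow_ne_top_of_nonneg (by positivity : 0 ≤ 1 / p) hA
    finiteness
  refine ⟨(K * A ^ (1 / p)).toReal + 1, by positivity, 1, fun N hN E hE f => ?_⟩
  rcases E.eq_empty_or_nonempty with rfl | hne
  · have h0 : haarProj ∅ f = fun _ => 0 := by
      ext x
      simp [haarProj]
    rw [h0, FNorm_zero _ hp0 hq0]
    exact zero_le
  have hbound := hmodel N hN (HFset E) hE (ZN E N) (one_le_ZN hne N) (card_window_le_ZN E N)
    (lpWeight φ (-1 + 1 / q) f) (measurable_lpWeight φ _ f)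
  rw [← hφ]
  refine (FNorm_le_of_le_haarModel hp0 hq hK (hpt E f) hbound).trans ?_
  rw [FNorm_schwartz_eq φ f hq0, ENNReal.mul_rpow_of_nonneg _ _ (by positivity),
    ENNReal.mul_rpow_of_nonneg _ _ (by positivity), ← mul_assoc, ← mul_assoc]
  refine mul_le_mul_left ?_ _
  have hNZ : ((((N : ℝ≥0∞) ^ (q - 1) * (ZN E N : ℕ)) ^ (p / q)) ^ (1 / p)) =
      ENNReal.ofReal ((N : ℝ) ^ (1 - 1 / q)) * ENNReal.ofReal ((ZN E N : ℝ) ^ (1 / q)) := by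
    rw [← ENNReal.rpow_mul, show p / q * (1 / p) = 1 / q by field_simp,
      ENNReal.mul_rpow_of_nonneg _ _ (by positivity), ← ENNReal.rpow_mul,
      show (q - 1) * (1 / q) = 1 - 1 / q by field_simp,
      ← ENNReal.ofReal_rpow_of_nonneg (Nat.cast_nonneg N) (by linarith),
      ← ENNReal.ofReal_rpow_of_nonneg (Nat.cast_nonneg _) (by positivity),
      ENNReal.ofReal_natCast, ENNReal.ofReal_natCast]
  rw [hNZ, mul_assoc (_ + 1), ENNReal.ofReal_mul (by positivity),
    ENNReal.ofReal_mul (by positivity)]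
  gcongr
  rw [← ENNReal.ofReal_toReal hfin]
  exact ENNReal.ofReal_le_ofReal (by rw [ENNReal.toReal_ofReal (by positivity)]; linarith)
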